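/- (Asymptotic completeness at the singularity for linearized Einstein–scalar field.) Assume the exponents are δ-subcritical for some δ > 0. Let λ ∈ ℤ^D \ {0} and let κ_{∞,i}{}^j, Υ_{∞,i}{}^j (1 ≤ i,j ≤ D), ψ_∞, φ̃_∞ be real numbers satisfying the asymptotic constraints: ∑_a κ_{∞,a}{}^a = 0; −∑_a p_aκ_{∞,a}{}^a + 2p_φψ_∞ = 0; for each i, ∑_j λ_jκ_{∞,i}{}^j + λ_i(−∑_a p_aΥ_{∞,a}{}^a + 2p_φφ̃_∞) + p_iλ_i∑_aΥ_{∞,a}{}^a = 0; for each c, ∑_a t_{λ*}^{−2p_a}λ_aκ_{∞,a}{}^c + t_{λ*}^{−2p_c}λ_c(−∑_a p_aΥ_{∞,a}{}^a + 2p_φφ̃_∞) + 2∑_a t_{λ*}^{−2p_a}p_aλ_aΥ_{∞,a}{}^c = 0; and for all a, c, t_{λ*}^{−2p_a}Υ_{∞,a}{}^c = t_{λ*}^{−2p_c}Υ_{∞,c}{}^a and t_{λ*}^{−2p_a}(κ_{∞,a}{}^c + 2p_aΥ_{∞,a}{}^c) = t_{λ*}^{−2p_c}(κ_{∞,c}{}^a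 + 2p_cΥ_{∞,c}{}^a). Then there exists a λ-mode CMCTC solution (η, κ, φ, ψ, ν) of the linearized Einstein–scalar field system on (0, t_{λ*}] such that κ_i{}^j(t) → κ_{∞,i}{}^j, Υ̃_i{}^j(t) → Υ_{∞,i}{}^j, ψ(t) → ψ_∞ and φ̃(t) → φ̃_∞ as t → 0⁺; it is the unique λ-mode CMCTC solution on (0, t_{λ*}] attaining these limits; and E_{λ,low}(t_{λ*}) ≤ C̊_low·(∑_{i,j} t_{λ*}^{−2p_i+2p_j}·((κ_{∞,i}{}^j)² + (Υ_{∞,i}{}^j)²) + ψ_∞² + φ̃_∞²), where C̊_low depends only on D, p_1,…,p_D, p_φ and δ. -/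

import Mathlib

open Real Filter MeasureTheory Topology

/-- τ_λ(t) = (∑ᵢ t^(2-2pᵢ) λᵢ²)^(1/2). -/
noncomputable def tau {D : ℕ} (p : Fin D → ℝ) (lam : Fin D → ℤ) (t : ℝ) : ℝ :=
  Real.sqrt (∑ i, t ^ (2 - 2 * p i) * ((lam i : ℝ)) ^ 2)

/-- A λ-mode CMCTC solution of the linearized Einstein–scalar field system on the
interval `I`: the projection of the linearized system in the constant-mean-curvature
transported-coordinate gauge (vanishing shift) onto the Fourier mode λ. -/
structure IsCMCTCSolution {D : ℕ} (p : Fin D → ℝ) (pphi : ℝ) (lam : Fin D → ℤ)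
    (η κ : ℝ → Fin D → Fin D → ℝ) (φ ψ ν : ℝ → ℝ) (I : Set ℝ) : Prop where
  cont_nu : ContinuousOn ν I
  eta_evol : ∀ t ∈ I, ∀ i j, HasDerivAt (fun s => η s i j)
    ((κ t i j + 2 * (p i - p j) * η t i j - p i * (if i = j then 1 else 0) * ν t) / t) t
  kappa_evol : ∀ t ∈ I, ∀ i j, HasDerivAt (fun s => κ s i j)
    ((-(tau p lam t ^ 2) * η t i j
      - t ^ (2 - 2 * p j) * (lam i : ℝ) * (lam j : ℝ) * (∑ a, η t a a)
      + (∑ a, t ^ (2 - 2 * p a) * (lam i : ℝ) * (lam a : ℝ) * η t a j)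
      + t ^ (2 - 2 * p j) * (lam j : ℝ) * (∑ b, (lam b : ℝ) * η t i b)
      + t ^ (2 - 2 * p j) * (lam i : ℝ) * (lam j : ℝ) * ν t
      + p i * (if i = j then 1 else 0) * ν t) / t) t
  phi_evol : ∀ t ∈ I, HasDerivAt φ ((ψ t + pphi * ν t) / t) t
  psi_evol : ∀ t ∈ I, HasDerivAt ψ ((-(tau p lam t ^ 2) * φ t - pphi * ν t) / t) t
  nu_elliptic : ∀ t ∈ I, (1 + tau p lam t ^ 2) * ν t =
    2 * tau p lam t ^ 2 * (∑ a, η t a a)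
      - 2 * ∑ a, ∑ i, t ^ (2 - 2 * p a) * (lam a : ℝ) * (lam i : ℝ) * η t a i
  cmc : ∀ t ∈ I, ∑ a, κ t a a = 0
  hamiltonian : ∀ t ∈ I,
    2 * tau p lam t ^ 2 * (∑ a, η t a a)
      - 2 * (∑ a, ∑ i, t ^ (2 - 2 * p a) * (lam a : ℝ) * (lam i : ℝ) * η t a i)
      - 2 * (∑ a, p a * κ t a a) + 4 * pphi * ψ t = 0
  momentum : ∀ t ∈ I, ∀ i,
    (∑ j, (lam j : ℝ) * κ t i j)
      + (lam i : ℝ) * (-(∑ a, p a * η t a a) + 2 * pphi * φ t)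
      + p i * (lam i : ℝ) * (∑ a, η t a a) = 0
  sym_eta : ∀ t ∈ I, ∀ a c,
    t ^ (-(2 * p a)) * η t a c = t ^ (-(2 * p c)) * η t c a
  sym_kappa : ∀ t ∈ I, ∀ a c,
    t ^ (-(2 * p a)) * (κ t a c + 2 * p a * η t a c)
      = t ^ (-(2 * p c)) * (κ t c a + 2 * p c * η t c a)

/-- G_i{}^j(t) = ∫_t^{t_{λ*}} s^{2pᵢ-2pⱼ} ds/s. -/
noncomputable def Gfun {D : ℕ} (p : Fin D → ℝ) (tstar : ℝ) (i j : Fin D) (t : ℝ) : ℝ :=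
  ∫ s in t..tstar, s ^ (2 * p i - 2 * p j - 1)

/-- The renormalized quantity Υ̃_i{}^j(t) = η_i{}^j(t) + G_i{}^j(t)·κ_j{}^i(t). -/
noncomputable def UpsT {D : ℕ} (p : Fin D → ℝ) (tstar : ℝ)
    (η κ : ℝ → Fin D → Fin D → ℝ) (t : ℝ) (i j : Fin D) : ℝ :=
  η t i j + Gfun p tstar i j t * κ t j i

/-- The renormalized scalar field φ̃(t) = φ(t) + log(t_{λ*}/t)·ψ(t). -/
noncomputable def phiT (φ ψ : ℝ → ℝ) (tstar t : ℝ) : ℝ :=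
  φ t + Real.log (tstar / t) * ψ t

/-- The low-frequency energy E_{λ,low} of the linearized Einstein–scalar field system. -/
noncomputable def ElowSys {D : ℕ} (p : Fin D → ℝ) (tstar : ℝ)
    (η κ : ℝ → Fin D → Fin D → ℝ) (φ ψ : ℝ → ℝ) (t : ℝ) : ℝ :=
  (∑ i, ∑ j, tstar ^ (-(2 * p i) + 2 * p j)
      * ((κ t i j) ^ 2 + (UpsT p tstar η κ t i j) ^ 2))
    + ψ t ^ 2 + phiT φ ψ tstar t ^ 2

section LinearODE

variable {E : Type*} [NormedAddCommGroup E] [NormedSpace ℝ E]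

/-- The Picard iteration on `[0, 2]`, conjugated by the weight `exp (M t)`. -/
noncomputable def weightedPicard (f : ℝ → E → E) (M : ℝ) (x₀ : E) (Y : C(Set.Icc (0 : ℝ) 2, E))
    (t : ℝ) : E :=
  Real.exp (-(M * t)) • (x₀ + ∫ s in (0 : ℝ)..t,
    f s (Real.exp (M * s) • Y (Set.projIcc 0 2 zero_le_two s)))

theorem continuous_weightedPicard_integrand {f : ℝ → E → E}
    (hf : Continuous (Function.uncurry f)) (M : ℝ) (Y : C(Set.Icc (0 : ℝ) 2, E)) :
    Continuous fun s => f s (Real.exp (M * s) • Y (Set.projIcc 0 2 zero_le_two s)) := by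
  have h : Continuous fun s : ℝ =>
      (s, Real.exp (M * s) • Y (Set.projIcc 0 2 zero_le_two s)) := by
    have := continuous_projIcc (a := (0 : ℝ)) (b := 2) (h := zero_le_two)
    fun_prop
  exact hf.comp h

theorem continuous_weightedPicard [CompleteSpace E] {f : ℝ → E → E}
    (hf : Continuous (Function.uncurry f)) (M : ℝ) (x₀ : E) (Y : C(Set.Icc (0 : ℝ) 2, E)) :
    Continuous (weightedPicard f M x₀ Y) := by
  have h := continuous_weightedPicard_integrand hf M Y
  have h2 : Continuous fun t => ∫ s in (0 : ℝ)..t,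
      f s (Real.exp (M * s) • Y (Set.projIcc 0 2 zero_le_two s)) :=
    continuous_iff_continuousAt.2 fun t =>
      (intervalIntegral.integral_hasDerivAt_right (h.intervalIntegrable _ _)
        (h.stronglyMeasurableAtFilter _ _) h.continuousAt).continuousAt
  unfold weightedPicard
  fun_prop

/-- Global solvability on `[0, 2]` of an ODE whose field is continuous and globally Lipschitz. -/
theorem exists_hasDerivAt_of_lipschitz [CompleteSpace E] {f : ℝ → E → E}
    (hf : Continuous (Function.uncurry f)) {K : ℝ} (hK : 0 < K)
    (hlip : ∀ t x y, ‖f t x - f t y‖ ≤ K * ‖x - y‖) (x₀ : E) :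
    ∃ X : ℝ → E, Tendsto X (𝓝[>] 0) (𝓝 x₀) ∧
      ∀ t ∈ Set.Ioo (0 : ℝ) 2, HasDerivAt X (f t (X t)) t := by
  set M : ℝ := 2 * K with hM
  have hM0 : 0 < M := by positivity
  let Φ : C(Set.Icc (0 : ℝ) 2, E) → C(Set.Icc (0 : ℝ) 2, E) := fun Y =>
    ⟨fun t => weightedPicard f M x₀ Y t,
      (continuous_weightedPicard hf M x₀ Y).comp continuous_subtype_val⟩
  have hΦ : ContractingWith (1 / 2) Φ := by
    refine ⟨by norm_num, LipschitzWith.of_dist_le_mul fun Y Z => ?_⟩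
    rw [ContinuousMap.dist_le (by positivity)]
    rintro ⟨t, ht0, ht2⟩
    have hYi := continuous_weightedPicard_integrand hf M Y
    have hZi := continuous_weightedPicard_integrand hf M Z
    have hint : ‖∫ s in (0 : ℝ)..t,
        (f s (Real.exp (M * s) • Y (Set.projIcc 0 2 zero_le_two s))
          - f s (Real.exp (M * s) • Z (Set.projIcc 0 2 zero_le_two s)))‖
        ≤ ∫ s in (0 : ℝ)..t, K * dist Y Z * Real.exp (M * s) := by
      refine intervalIntegral.norm_integral_le_of_norm_le ht0 (ae_of_all _ fun s _ => ?_)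
        (Continuous.intervalIntegrable (by fun_prop) _ _)
      refine (hlip _ _ _).trans ?_
      rw [← smul_sub, norm_smul, Real.norm_of_nonneg (Real.exp_pos _).le, ← dist_eq_norm]
      have := ContinuousMap.dist_apply_le_dist (f := Y) (g := Z)
        (Set.projIcc 0 2 zero_le_two s)
      have he := (Real.exp_pos (M * s)).le
      calc K * (rexp (M * s) * dist _ _) ≤ K * (rexp (M * s) * dist Y Z) := by gcongr
        _ = _ := by ring
    have hval : ∫ s in (0 : ℝ)..t, K * dist Y Z * Real.exp (M * s)
        = K * dist Y Z * ((Real.exp (M * t) - 1) / M) := by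
      have hd : ∀ s ∈ Set.uIcc 0 t, HasDerivAt (fun s => K * dist Y Z * (Real.exp (M * s) / M))
          (K * dist Y Z * Real.exp (M * s)) s := by
        intro s _
        have h1 : HasDerivAt (fun s => Real.exp (M * s)) (Real.exp (M * s) * M) s := by
          simpa using ((hasDerivAt_id s).const_mul M).exp
        have := (h1.div_const M).const_mul (K * dist Y Z)
        exact this.congr_deriv (by rw [mul_div_cancel_right₀ _ hM0.ne'])
      rw [intervalIntegral.integral_eq_sub_of_hasDerivAt hd
        (Continuous.intervalIntegrable (by fun_prop) _ _)]
      simp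
      ring
    change dist (weightedPicard f M x₀ Y t) (weightedPicard f M x₀ Z t) ≤ _
    have hsub : weightedPicard f M x₀ Y t - weightedPicard f M x₀ Z t
        = Real.exp (-(M * t)) • ∫ s in (0 : ℝ)..t,
          (f s (Real.exp (M * s) • Y (Set.projIcc 0 2 zero_le_two s))
            - f s (Real.exp (M * s) • Z (Set.projIcc 0 2 zero_le_two s))) := by
      rw [intervalIntegral.integral_sub (hYi.intervalIntegrable _ _) (hZi.intervalIntegrable _ _)]
      simp only [weightedPicard, ← smul_sub]
      congr 1
      abel
    rw [dist_eq_norm, hsub, norm_smul, Real.norm_of_nonneg (Real.exp_pos _).le]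
    have hd0 : 0 ≤ dist Y Z := dist_nonneg
    have hee : Real.exp (-(M * t)) * Real.exp (M * t) = 1 := by
      rw [← Real.exp_add]; simp
    calc _ ≤ Real.exp (-(M * t)) * (K * dist Y Z * ((Real.exp (M * t) - 1) / M)) := by
          rw [← hval]; gcongr
      _ = (Real.exp (-(M * t)) * Real.exp (M * t) - Real.exp (-(M * t))) * dist Y Z / 2 := by
          rw [hM]; field_simp
      _ ≤ _ := by
          rw [hee]
          have := mul_nonneg (Real.exp_pos (-(M * t))).le hd0
          push_cast
          linarith
  obtain ⟨Y, hY, -⟩ := hΦ.exists_fixedPoint (0 : C(Set.Icc (0 : ℝ) 2, E)) (edist_ne_top _ _)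
  have hYi := continuous_weightedPicard_integrand hf M Y
  let X : ℝ → E := fun t => x₀ + ∫ s in (0 : ℝ)..t,
    f s (Real.exp (M * s) • Y (Set.projIcc 0 2 zero_le_two s))
  have hX : ∀ t, HasDerivAt X (f t (Real.exp (M * t) • Y (Set.projIcc 0 2 zero_le_two t))) t :=
    fun t => (intervalIntegral.integral_hasDerivAt_right (hYi.intervalIntegrable _ _)
      (hYi.stronglyMeasurableAtFilter _ _) hYi.continuousAt).const_add x₀
  refine ⟨X, ?_, fun t ht => ?_⟩
  · have := (hX 0).continuousAt.tendsto
    have h0 : X 0 = x₀ := by simp [X]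
    rw [h0] at this
    exact this.mono_left nhdsWithin_le_nhds
  · have hfix : Y ⟨t, ht.1.le, ht.2.le⟩ = weightedPicard f M x₀ Y t :=
      (DFunLike.congr_fun hY.symm ⟨t, ht.1.le, ht.2.le⟩)
    have hXY : Real.exp (M * t) • Y (Set.projIcc 0 2 zero_le_two t) = X t := by
      rw [Set.projIcc_of_mem zero_le_two ⟨ht.1.le, ht.2.le⟩, hfix, weightedPicard, smul_smul,
        ← Real.exp_add]
      simp [X]
    have := hX t
    rwa [hXY] at this

/-- An initial value problem at the regular singular point `t = 0` for a field which decays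
like a power of `t`. -/
theorem exists_hasDerivAt_of_singular [CompleteSpace E] {F : ℝ → E → E} {C ε : ℝ} (hε : 0 < ε)
    (hC : 0 < C) (hcont : ContinuousOn (Function.uncurry F) (Set.Ioc (0 : ℝ) 1 ×ˢ Set.univ))
    (hlip : ∀ t ∈ Set.Ioc (0 : ℝ) 1, ∀ x y, ‖F t x - F t y‖ ≤ C * t ^ (2 * ε) * ‖x - y‖)
    (hzero : ∀ t ∈ Set.Ioc (0 : ℝ) 1, F t 0 = 0) (x₀ : E) :
    ∃ X : ℝ → E, Tendsto X (𝓝[>] 0) (𝓝 x₀) ∧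
      ∀ t ∈ Set.Ioc (0 : ℝ) 1, HasDerivAt X (t⁻¹ • F t (X t)) t := by
  let B : ℝ → E → E := fun s x => (ε * s)⁻¹ • F (s ^ ε⁻¹) x
  have hpow : ∀ s ∈ Set.Ioc (0 : ℝ) 1, s ^ ε⁻¹ ∈ Set.Ioc (0 : ℝ) 1 := fun s hs =>
    ⟨Real.rpow_pos_of_pos hs.1 _, Real.rpow_le_one hs.1.le hs.2 (by positivity)⟩
  have hBlip : ∀ s ∈ Set.Icc (0 : ℝ) 1, ∀ x y, ‖B s x - B s y‖ ≤ C / ε * s * ‖x - y‖ := by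
    intro s hs x y
    rcases hs.1.eq_or_lt with h0 | h0
    · simp [B, ← h0]
    · simp only [B, ← smul_sub, norm_smul]
      have h1 := hlip _ (hpow s ⟨h0, hs.2⟩) x y
      rw [← Real.rpow_mul h0.le, show ε⁻¹ * (2 * ε) = (2 : ℕ) by field_simp; norm_num,
        Real.rpow_natCast] at h1
      rw [Real.norm_of_nonneg (by positivity)]
      calc (ε * s)⁻¹ * _ ≤ (ε * s)⁻¹ * (C * s ^ 2 * ‖x - y‖) := by gcongr
        _ = _ := by field_simp
  have hBzero : ∀ s ∈ Set.Icc (0 : ℝ) 1, B s 0 = 0 := by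
    intro s hs
    rcases hs.1.eq_or_lt with h0 | h0
    · simp [B, ← h0]
    · simp [B, hzero _ (hpow s ⟨h0, hs.2⟩)]
  have hBcont : ContinuousOn (Function.uncurry B) (Set.Icc (0 : ℝ) 1 ×ˢ Set.univ) := by
    rintro ⟨s, x⟩ ⟨hs, -⟩
    rcases hs.1.eq_or_lt with h0 | h0
    · have hs0 : s = 0 := h0.symm
      subst hs0
      have hval : Function.uncurry B (0, x) = 0 := by simp [B]
      rw [ContinuousWithinAt, hval]
      refine squeeze_zero_norm' (a := fun q : ℝ × E => C / ε * q.1 * ‖q.2‖) ?_ ?_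
      · filter_upwards [self_mem_nhdsWithin] with q hq
        have := hBlip q.1 hq.1 q.2 0
        rwa [hBzero q.1 hq.1, sub_zero, sub_zero] at this
      · have : Continuous fun q : ℝ × E => C / ε * q.1 * ‖q.2‖ := by fun_prop
        have := (this.tendsto (0, x)).mono_left
          (nhdsWithin_le_nhds (s := Set.Icc (0 : ℝ) 1 ×ˢ Set.univ))
        simpa using this
    · have h1 : ContinuousWithinAt (Function.uncurry F) (Set.Ioc (0 : ℝ) 1 ×ˢ Set.univ)
          (s ^ ε⁻¹, x) := hcont _ ⟨hpow s ⟨h0, hs.2⟩, trivial⟩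
      have h2 : ContinuousWithinAt (fun q : ℝ × E => (q.1 ^ ε⁻¹, q.2))
          (Set.Ioc (0 : ℝ) 1 ×ˢ Set.univ) (s, x) := by
        refine ContinuousAt.continuousWithinAt ?_
        exact ((continuousAt_fst.rpow_const (Or.inl h0.ne')).prodMk continuousAt_snd)
      have h3 : ContinuousWithinAt (fun q : ℝ × E => F (q.1 ^ ε⁻¹) q.2)
          (Set.Ioc (0 : ℝ) 1 ×ˢ Set.univ) (s, x) :=
        ContinuousWithinAt.comp (g := Function.uncurry F) (f := fun q : ℝ × E => (q.1 ^ ε⁻¹, q.2))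
          h1 h2 (fun q hq => ⟨hpow _ hq.1, trivial⟩)
      have h4 : ContinuousWithinAt (fun q : ℝ × E => (ε * q.1)⁻¹)
          (Set.Ioc (0 : ℝ) 1 ×ˢ Set.univ) (s, x) := by
        refine ContinuousAt.continuousWithinAt ?_
        exact (continuousAt_const.mul continuousAt_fst).inv₀ (mul_pos hε h0).ne'
      refine (h4.smul h3).mono_of_mem_nhdsWithin ?_
      have : (Set.Ioi (0 : ℝ) ×ˢ (Set.univ : Set E)) ∈ 𝓝 (s, x) :=
        prod_mem_nhds (Ioi_mem_nhds h0) univ_mem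
      filter_upwards [mem_nhdsWithin_of_mem_nhds this, self_mem_nhdsWithin] with q hq hq'
      exact ⟨⟨hq.1, hq'.1.2⟩, trivial⟩
  let r : ℝ → ℝ := fun s => max 0 (min s 1)
  have hr : ∀ s, r s ∈ Set.Icc (0 : ℝ) 1 := fun s => ⟨le_max_left _ _, by simp [r]⟩
  have hrc : Continuous r := by fun_prop
  have hfc : Continuous (Function.uncurry fun s x => B (r s) x) := by
    rw [← continuousOn_univ]
    refine ContinuousOn.comp (g := Function.uncurry B) (f := fun q : ℝ × E => (r q.1, q.2))
      hBcont (by fun_prop) (fun q _ => ⟨hr _, trivial⟩)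
  obtain ⟨Z, hZ0, hZ⟩ := exists_hasDerivAt_of_lipschitz hfc (K := C / ε) (by positivity)
    (fun t x y => (hBlip _ (hr t) x y).trans (by
      have := (hr t).2
      have : C / ε * r t ≤ C / ε * 1 := by gcongr
      gcongr
      linarith)) x₀
  refine ⟨fun t => Z (t ^ ε), ?_, fun t ht => ?_⟩
  · refine hZ0.comp (tendsto_nhdsWithin_iff.2 ⟨?_, ?_⟩)
    · have := (Real.continuousAt_rpow_const 0 ε (Or.inr hε.le)).tendsto
      rw [Real.zero_rpow hε.ne'] at this
      exact this.mono_left nhdsWithin_le_nhds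
    · filter_upwards [self_mem_nhdsWithin] with t ht
      exact Real.rpow_pos_of_pos ht _
  · have hs0 : 0 < t ^ ε := Real.rpow_pos_of_pos ht.1 _
    have hs1 : t ^ ε ≤ 1 := Real.rpow_le_one ht.1.le ht.2 hε.le
    have hrt : r (t ^ ε) = t ^ ε := by simp [r, hs1, hs0.le]
    have h1 := hZ (t ^ ε) ⟨hs0, by linarith⟩
    have h2 : HasDerivAt (fun t : ℝ => t ^ ε) (ε * t ^ (ε - 1)) t :=
      Real.hasDerivAt_rpow_const (Or.inl ht.1.ne')
    have h3 := h1.scomp t h2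
    refine h3.congr_deriv ?_
    simp only [hrt, B]
    rw [← Real.rpow_mul ht.1.le, mul_inv_cancel₀ hε.ne', Real.rpow_one, smul_smul]
    congr 1
    rw [Real.rpow_sub_one ht.1.ne']
    field_simp

/-- Grönwall's inequality from the singular point `t = 0`. -/
theorem norm_le_of_singular {X v : ℝ → E} {C ε : ℝ} (hε : 0 < ε) (hC : 0 < C)
    (hX : ∀ t ∈ Set.Ioc (0 : ℝ) 1, HasDerivAt X (t⁻¹ • v t) t)
    (hv : ∀ t ∈ Set.Ioc (0 : ℝ) 1, ‖v t‖ ≤ C * t ^ ε * ‖X t‖) {x₀ : E}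
    (hx₀ : Tendsto X (𝓝[>] 0) (𝓝 x₀)) :
    ∀ t ∈ Set.Ioc (0 : ℝ) 1, ‖X t‖ ≤ Real.exp (C / ε) * ‖x₀‖ := by
  intro t ht
  let Y : ℝ → E := fun s => X (s ^ ε⁻¹)
  have hpow : ∀ s ∈ Set.Ioc (0 : ℝ) 1, s ^ ε⁻¹ ∈ Set.Ioc (0 : ℝ) 1 := fun s hs =>
    ⟨Real.rpow_pos_of_pos hs.1 _, Real.rpow_le_one hs.1.le hs.2 (by positivity)⟩
  have hY : ∀ s ∈ Set.Ioc (0 : ℝ) 1,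
      HasDerivAt Y ((ε⁻¹ * s ^ (ε⁻¹ - 1)) • ((s ^ ε⁻¹)⁻¹ • v (s ^ ε⁻¹))) s := fun s hs =>
    (hX _ (hpow s hs)).scomp s (Real.hasDerivAt_rpow_const (Or.inl hs.1.ne'))
  have hbound : ∀ s ∈ Set.Ioc (0 : ℝ) 1,
      ‖(ε⁻¹ * s ^ (ε⁻¹ - 1)) • ((s ^ ε⁻¹)⁻¹ • v (s ^ ε⁻¹))‖ ≤ C / ε * ‖Y s‖ + 0 := by
    intro s hs
    have h1 := hv _ (hpow s hs)
    have hp := (hpow s hs).1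
    rw [← Real.rpow_mul hs.1.le, inv_mul_cancel₀ hε.ne', Real.rpow_one] at h1
    rw [smul_smul, norm_smul, Real.rpow_sub_one hs.1.ne']
    have hs0 := hs.1
    rw [Real.norm_of_nonneg (by positivity)]
    calc _ ≤ (ε⁻¹ * (s ^ ε⁻¹ / s) * (s ^ ε⁻¹)⁻¹) * (C * s * ‖X (s ^ ε⁻¹)‖) := by gcongr
      _ = _ := by field_simp; simp [Y]
  have hts : t ^ ε ∈ Set.Ioc (0 : ℝ) 1 :=
    ⟨Real.rpow_pos_of_pos ht.1 _, Real.rpow_le_one ht.1.le ht.2 hε.le⟩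
  have hYt : Y (t ^ ε) = X t := by
    simp only [Y]
    rw [← Real.rpow_mul ht.1.le, mul_inv_cancel₀ hε.ne', Real.rpow_one]
  have key : ∀ a ∈ Set.Ioc (0 : ℝ) (t ^ ε), ‖X t‖ ≤ Real.exp (C / ε) * ‖Y a‖ := by
    intro a ha
    have hsub : ∀ s ∈ Set.Icc a (t ^ ε), s ∈ Set.Ioc (0 : ℝ) 1 := fun s hs =>
      ⟨ha.1.trans_le hs.1, hs.2.trans hts.2⟩
    have := norm_le_gronwallBound_of_norm_deriv_right_le (f := Y)
      (fun s hs => (hY s (hsub s hs)).continuousAt.continuousWithinAt)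
      (fun s hs => (hY s (hsub s ⟨hs.1, hs.2.le⟩)).hasDerivWithinAt) le_rfl
      (fun s hs => hbound s (hsub s ⟨hs.1, hs.2.le⟩)) (t ^ ε) ⟨ha.2, le_rfl⟩
    rw [hYt, gronwallBound_ε0] at this
    refine this.trans ?_
    rw [mul_comm]
    have h1 : C / ε * (t ^ ε - a) ≤ C / ε := by
      have : t ^ ε - a ≤ 1 := by linarith [hts.2, ha.1]
      have h0 : 0 ≤ C / ε := by positivity
      nlinarith
    gcongr
  have hlim : Tendsto Y (𝓝[>] 0) (𝓝 x₀) := by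
    refine hx₀.comp (tendsto_nhdsWithin_iff.2 ⟨?_, ?_⟩)
    · have := (Real.continuousAt_rpow_const 0 ε⁻¹ (Or.inr (by positivity))).tendsto
      rw [Real.zero_rpow (by positivity)] at this
      exact this.mono_left nhdsWithin_le_nhds
    · filter_upwards [self_mem_nhdsWithin] with t ht
      exact Real.rpow_pos_of_pos ht _
  refine ge_of_tendsto (hlim.norm.const_mul _) ?_
  filter_upwards [Ioc_mem_nhdsGT hts.1] with a ha using key a ha

end LinearODE

section WeightIntegral

/-- The integral `∫_t^1 s^q ds/s`. -/
noncomputable def weightInt (q t : ℝ) : ℝ := ∫ s in t..1, s ^ (q - 1)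

theorem intervalIntegrable_rpow_of_pos {q a b : ℝ} (ha : 0 < a) (hb : 0 < b) :
    IntervalIntegrable (fun s : ℝ => s ^ q) volume a b := by
  refine ContinuousOn.intervalIntegrable fun s hs => ?_
  have hs0 : 0 < s := (lt_min ha hb).trans_le hs.1
  exact (Real.continuousAt_rpow_const s q (Or.inl hs0.ne')).continuousWithinAt

theorem hasDerivAt_weightInt (q : ℝ) {t : ℝ} (ht : 0 < t) :
    HasDerivAt (weightInt q) (-t ^ (q - 1)) t := by
  have hc : ContinuousOn (fun s : ℝ => s ^ (q - 1)) (Set.Ioi 0) := fun s hs =>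
    (Real.continuousAt_rpow_const s _ (Or.inl (ne_of_gt hs))).continuousWithinAt
  exact intervalIntegral.integral_hasDerivAt_left
    (intervalIntegrable_rpow_of_pos ht one_pos)
    (hc.stronglyMeasurableAtFilter isOpen_Ioi t ht)
    (hc.continuousAt (Ioi_mem_nhds ht))

theorem weightInt_zero {t : ℝ} (ht : 0 < t) : weightInt 0 t = -Real.log t := by
  simp only [weightInt, zero_sub, Real.rpow_neg_one]
  rw [integral_inv_of_pos ht one_pos, one_div, Real.log_inv]

/-- The elementary primitive behind the duality between `weightInt q` and `weightInt (-q)`. -/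
theorem mul_weightInt (q : ℝ) {t : ℝ} (ht : 0 < t) : q * weightInt q t = 1 - t ^ q := by
  have hd : ∀ s ∈ Set.uIcc t 1, HasDerivAt (fun s : ℝ => s ^ q) (q * s ^ (q - 1)) s := by
    intro s hs
    have hs0 : 0 < s := (lt_min ht one_pos).trans_le hs.1
    exact Real.hasDerivAt_rpow_const (Or.inl hs0.ne')
  have := intervalIntegral.integral_eq_sub_of_hasDerivAt hd
    ((intervalIntegrable_rpow_of_pos ht one_pos).const_mul q)
  rw [intervalIntegral.integral_const_mul, Real.one_rpow] at this
  exact this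

theorem rpow_mul_weightInt_neg (q : ℝ) {t : ℝ} (ht : 0 < t) :
    t ^ q * weightInt (-q) t = weightInt q t := by
  rcases eq_or_ne q 0 with rfl | hq
  · simp
  · have h1 := mul_weightInt q ht
    have h2 := mul_weightInt (-q) ht
    have h3 : t ^ q * t ^ (-q) = 1 := by rw [← Real.rpow_add ht]; simp
    apply mul_left_cancel₀ hq
    rw [h1]
    linear_combination (-t ^ q) * h2 + h3

theorem weightInt_nonneg (q : ℝ) {t : ℝ} (ht : t ∈ Set.Ioc (0 : ℝ) 1) : 0 ≤ weightInt q t :=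
  intervalIntegral.integral_nonneg ht.2 fun _ hs =>
    Real.rpow_nonneg (ht.1.le.trans hs.1) _

theorem weightInt_le (q : ℝ) {t : ℝ} (ht : t ∈ Set.Ioc (0 : ℝ) 1) :
    weightInt q t ≤ (1 + t ^ q) * (-Real.log t) := by
  have hval : ∫ s in t..1, (1 + t ^ q) * s⁻¹ = (1 + t ^ q) * (-Real.log t) := by
    rw [intervalIntegral.integral_const_mul, integral_inv_of_pos ht.1 one_pos, one_div,
      Real.log_inv]
  rw [← hval]
  refine intervalIntegral.integral_mono_on ht.2 (intervalIntegrable_rpow_of_pos ht.1 one_pos)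
    ?_ fun s hs => ?_
  · have := (intervalIntegrable_rpow_of_pos (q := -1) ht.1 one_pos).const_mul (1 + t ^ q)
    simpa only [Real.rpow_neg_one] using this
  · have hs0 : 0 < s := ht.1.trans_le hs.1
    rw [Real.rpow_sub_one hs0.ne', div_eq_mul_inv]
    have : s ^ q ≤ 1 + t ^ q := by
      rcases le_total 0 q with hq | hq
      · have := Real.rpow_le_one hs0.le hs.2 hq
        have := Real.rpow_nonneg ht.1.le q
        linarith
      · have := Real.rpow_le_rpow_of_nonpos ht.1 hs.1 hq
        linarith
    gcongr

end WeightIntegral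

section Mode

variable {D : ℕ}

/-- `τ² = ∑ₖ t^(2-2pₖ) μₖ²` for a real wave vector `μ`. -/
noncomputable def tauSq (p μ : Fin D → ℝ) (t : ℝ) : ℝ :=
  ∑ k, t ^ (2 - 2 * p k) * μ k ^ 2

/-- The quadratic contraction `∑ t^(2-2pₐ) μₐ μᵢ ηₐⁱ`. -/
noncomputable def contraction (p μ : Fin D → ℝ) (t : ℝ) (h : Fin D → Fin D → ℝ) : ℝ :=
  ∑ a, ∑ i, t ^ (2 - 2 * p a) * μ a * μ i * h a i

/-- The right-hand side of the elliptic equation for the lapse. -/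
noncomputable def lapseSource (p μ : Fin D → ℝ) (t : ℝ) (h : Fin D → Fin D → ℝ) : ℝ :=
  2 * tauSq p μ t * (∑ a, h a a) - 2 * contraction p μ t h

/-- The solution of the elliptic equation for the lapse. -/
noncomputable def lapse (p μ : Fin D → ℝ) (t : ℝ) (h : Fin D → Fin D → ℝ) : ℝ :=
  lapseSource p μ t h / (1 + tauSq p μ t)

/-- The right-hand side of the evolution equation for `κ`. -/
noncomputable def kapSource (p μ : Fin D → ℝ) (t : ℝ) (h : Fin D → Fin D → ℝ) (n : ℝ)
    (i j : Fin D) : ℝ :=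
  -(tauSq p μ t) * h i j
    - t ^ (2 - 2 * p j) * μ i * μ j * (∑ a, h a a)
    + (∑ a, t ^ (2 - 2 * p a) * μ i * μ a * h a j)
    + t ^ (2 - 2 * p j) * μ j * (∑ b, μ b * h i b)
    + t ^ (2 - 2 * p j) * μ i * μ j * n
    + p i * (if i = j then 1 else 0) * n

/-- The evolution equations and the elliptic equation of the linearized system on `(0, T]`, for a
real wave vector `μ`, without the constraints. -/
structure IsModeEvolution (p : Fin D → ℝ) (pphi : ℝ) (μ : Fin D → ℝ)
    (η κ : ℝ → Fin D → Fin D → ℝ) (φ ψ ν : ℝ → ℝ) (T : ℝ) : Prop where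
  eta_evol : ∀ t ∈ Set.Ioc 0 T, ∀ i j, HasDerivAt (fun s => η s i j)
    ((κ t i j + 2 * (p i - p j) * η t i j - p i * (if i = j then 1 else 0) * ν t) / t) t
  kappa_evol : ∀ t ∈ Set.Ioc 0 T, ∀ i j, HasDerivAt (fun s => κ s i j)
    (kapSource p μ t (η t) (ν t) i j / t) t
  phi_evol : ∀ t ∈ Set.Ioc 0 T, HasDerivAt φ ((ψ t + pphi * ν t) / t) t
  psi_evol : ∀ t ∈ Set.Ioc 0 T, HasDerivAt ψ ((-(tauSq p μ t) * φ t - pphi * ν t) / t) t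
  nu_elliptic : ∀ t ∈ Set.Ioc 0 T, (1 + tauSq p μ t) * ν t = lapseSource p μ t (η t)

/-- The regularized unknowns `(κ, z, ψ, φ̃)`, where `z` is the transpose of the renormalized
metric perturbation. -/
abbrev ModeState (D : ℕ) : Type :=
  (Fin D → Fin D → ℝ) × (Fin D → Fin D → ℝ) × ℝ × ℝ

/-- The metric perturbation recovered from the regularized unknowns. -/
noncomputable def etaOf (p : Fin D → ℝ) (t : ℝ) (x : ModeState D) (i j : Fin D) : ℝ :=
  t ^ (2 * p i - 2 * p j) * (x.2.1 i j - weightInt (2 * p j - 2 * p i) t * x.1 i j)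

/-- The scalar field recovered from the regularized unknowns. -/
noncomputable def phiOf (t : ℝ) (x : ModeState D) : ℝ := x.2.2.2 + Real.log t * x.2.2.1

/-- The lapse recovered from the regularized unknowns. -/
noncomputable def nuOf (p μ : Fin D → ℝ) (t : ℝ) (x : ModeState D) : ℝ :=
  lapse p μ t (etaOf p t x)

/-- The right-hand side of the evolution equation for `κ` in terms of the regularized unknowns. -/
noncomputable def kapField (p μ : Fin D → ℝ) (t : ℝ) (x : ModeState D) (i j : Fin D) : ℝ :=
  kapSource p μ t (etaOf p t x) (nuOf p μ t x) i j

/-- The right-hand side of the evolution equation for `ψ` in terms of the regularized unknowns. -/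
noncomputable def psiField (p : Fin D → ℝ) (pphi : ℝ) (μ : Fin D → ℝ) (t : ℝ)
    (x : ModeState D) : ℝ :=
  -(tauSq p μ t) * phiOf t x - pphi * nuOf p μ t x

/-- The vector field governing the regularized unknowns with respect to `t d/dt`. -/
noncomputable def modeField (p : Fin D → ℝ) (pphi : ℝ) (μ : Fin D → ℝ) (t : ℝ)
    (x : ModeState D) : ModeState D :=
  (kapField p μ t x,
   fun i j => -(p i * (if i = j then 1 else 0) * nuOf p μ t x)
     + weightInt (2 * p j - 2 * p i) t * kapField p μ t x i j,
   psiField p pphi μ t x,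
   pphi * nuOf p μ t x - Real.log t * psiField p pphi μ t x)

/-- The regularized unknowns of a mode. -/
noncomputable def stateOf (p : Fin D → ℝ) (η κ : ℝ → Fin D → Fin D → ℝ) (φ ψ : ℝ → ℝ)
    (t : ℝ) : ModeState D :=
  (κ t,
   fun i j => t ^ (2 * p j - 2 * p i) * η t i j + weightInt (2 * p j - 2 * p i) t * κ t i j,
   ψ t, φ t - Real.log t * ψ t)

theorem tauSq_nonneg (p μ : Fin D → ℝ) {t : ℝ} (ht : 0 < t) : 0 ≤ tauSq p μ t :=
  Finset.sum_nonneg fun k _ => by positivity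

theorem one_add_tauSq_pos (p μ : Fin D → ℝ) {t : ℝ} (ht : 0 < t) : 0 < 1 + tauSq p μ t := by
  have := tauSq_nonneg p μ ht
  linarith

theorem rpow_mul_rpow_swap {t : ℝ} (ht : 0 < t) (a b : ℝ) :
    t ^ (a - b) * t ^ (b - a) = 1 := by
  rw [← Real.rpow_add ht]; simp

theorem etaOf_stateOf (p : Fin D → ℝ) (η κ : ℝ → Fin D → Fin D → ℝ) (φ ψ : ℝ → ℝ)
    {t : ℝ} (ht : 0 < t) : etaOf p t (stateOf p η κ φ ψ t) = η t := by
  funext i j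
  simp only [etaOf, stateOf]
  linear_combination (η t i j) * rpow_mul_rpow_swap ht (2 * p i) (2 * p j)

theorem phiOf_stateOf (p : Fin D → ℝ) (η κ : ℝ → Fin D → Fin D → ℝ) (φ ψ : ℝ → ℝ)
    (t : ℝ) : phiOf t (stateOf p η κ φ ψ t) = φ t := by
  simp [phiOf, stateOf]

theorem IsModeEvolution.nuOf_stateOf {p : Fin D → ℝ} {pphi : ℝ} {μ : Fin D → ℝ}
    {η κ : ℝ → Fin D → Fin D → ℝ} {φ ψ ν : ℝ → ℝ} {T : ℝ}
    (h : IsModeEvolution p pphi μ η κ φ ψ ν T) {t : ℝ} (ht : t ∈ Set.Ioc 0 T) :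
    nuOf p μ t (stateOf p η κ φ ψ t) = ν t := by
  have h1 := one_add_tauSq_pos p μ ht.1
  rw [nuOf, etaOf_stateOf p η κ φ ψ ht.1, lapse, ← h.nu_elliptic t ht]
  field_simp

/-- The regularized unknowns of a mode solve the regularized system. -/
theorem IsModeEvolution.hasDerivAt_stateOf {p : Fin D → ℝ} {pphi : ℝ} {μ : Fin D → ℝ}
    {η κ : ℝ → Fin D → Fin D → ℝ} {φ ψ ν : ℝ → ℝ} {T : ℝ}
    (h : IsModeEvolution p pphi μ η κ φ ψ ν T) {t : ℝ} (ht : t ∈ Set.Ioc 0 T) :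
    HasDerivAt (stateOf p η κ φ ψ)
      (t⁻¹ • modeField p pphi μ t (stateOf p η κ φ ψ t)) t := by
  have ht0 : t ≠ 0 := ht.1.ne'
  have hη := etaOf_stateOf p η κ φ ψ ht.1
  have hν := h.nuOf_stateOf ht
  have hφ := phiOf_stateOf p η κ φ ψ t
  have hlog := Real.hasDerivAt_log ht0
  refine HasDerivAt.prodMk ?_ (HasDerivAt.prodMk ?_ (HasDerivAt.prodMk ?_ ?_))
  · refine hasDerivAt_pi.2 fun i => hasDerivAt_pi.2 fun j => (h.kappa_evol t ht i j).congr_deriv ?_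
    simp only [modeField, kapField, hη, hν, Pi.smul_apply, smul_eq_mul]
    field_simp
  · refine hasDerivAt_pi.2 fun i => hasDerivAt_pi.2 fun j => ?_
    have h1 : HasDerivAt (fun s : ℝ => s ^ (2 * p j - 2 * p i))
        ((2 * p j - 2 * p i) * t ^ (2 * p j - 2 * p i - 1)) t :=
      Real.hasDerivAt_rpow_const (Or.inl ht0)
    refine ((h1.mul (h.eta_evol t ht i j)).add
      ((hasDerivAt_weightInt (2 * p j - 2 * p i) ht.1).mul (h.kappa_evol t ht i j))).congr_deriv ?_
    simp only [modeField, kapField, hη, hν, Pi.smul_apply, smul_eq_mul]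
    rw [Real.rpow_sub_one ht0]
    rcases eq_or_ne i j with rfl | hij
    · simp
      field_simp
      ring
    · simp only [if_neg hij]
      field_simp
      ring
  · refine (h.psi_evol t ht).congr_deriv ?_
    simp only [modeField, psiField, hφ, hν, smul_eq_mul]
    field_simp
  · refine ((h.phi_evol t ht).sub (hlog.mul (h.psi_evol t ht))).congr_deriv ?_
    simp only [modeField, psiField, hφ, hν, smul_eq_mul]
    field_simp
    ring

/-- Solutions of the regularized system give modes. -/
theorem isModeEvolution_of_hasDerivAt {p : Fin D → ℝ} {pphi : ℝ} {μ : Fin D → ℝ}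
    {X : ℝ → ModeState D} {T : ℝ}
    (h : ∀ t ∈ Set.Ioc 0 T, HasDerivAt X (t⁻¹ • modeField p pphi μ t (X t)) t) :
    IsModeEvolution p pphi μ (fun t => etaOf p t (X t)) (fun t => (X t).1)
      (fun t => phiOf t (X t)) (fun t => (X t).2.2.1) (fun t => nuOf p μ t (X t)) T := by
  have hκ : ∀ t ∈ Set.Ioc 0 T, ∀ i j,
      HasDerivAt (fun s => (X s).1 i j) (kapField p μ t (X t) i j / t) t := by
    intro t ht i j
    refine (hasDerivAt_pi.1 (hasDerivAt_pi.1 (h t ht).fst i) j).congr_deriv ?_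
    simp [modeField, div_eq_inv_mul]
  have hψ : ∀ t ∈ Set.Ioc 0 T,
      HasDerivAt (fun s => (X s).2.2.1) (psiField p pphi μ t (X t) / t) t := by
    intro t ht
    have h1 : HasDerivAt (fun s => (X s).2.2.1)
        (t⁻¹ • modeField p pphi μ t (X t)).2.2.1 t := (h t ht).snd.snd.fst
    refine h1.congr_deriv ?_
    simp [modeField, div_eq_inv_mul]
  refine ⟨fun t ht i j => ?_, hκ, fun t ht => ?_, hψ, fun t ht => ?_⟩
  · have ht0 : t ≠ 0 := ht.1.ne'
    have h1 : HasDerivAt (fun s : ℝ => s ^ (2 * p i - 2 * p j))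
        ((2 * p i - 2 * p j) * t ^ (2 * p i - 2 * p j - 1)) t :=
      Real.hasDerivAt_rpow_const (Or.inl ht0)
    have h2 := hasDerivAt_pi.1 (hasDerivAt_pi.1 (h t ht).snd.fst i) j
    have h3 := hasDerivAt_weightInt (2 * p j - 2 * p i) ht.1
    refine (h1.mul (h2.sub (h3.mul (hκ t ht i j)))).congr_deriv ?_
    have hsw := rpow_mul_rpow_swap ht.1 (2 * p i) (2 * p j)
    simp only [modeField, etaOf, Pi.smul_apply, Prod.smul_fst, Prod.smul_snd, smul_eq_mul,
      Pi.sub_apply, Pi.mul_apply]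
    rw [Real.rpow_sub_one ht0, Real.rpow_sub_one ht0]
    rcases eq_or_ne i j with rfl | hij
    · simp
      field_simp
      ring
    · simp only [if_neg hij]
      generalize t ^ (2 * p i - 2 * p j) = A at hsw ⊢
      generalize t ^ (2 * p j - 2 * p i) = B at hsw ⊢
      field_simp
      linear_combination ((X t).1 i j) * hsw
  · have ht0 : t ≠ 0 := ht.1.ne'
    have h1 : HasDerivAt (fun s => (X s).2.2.2)
        (t⁻¹ • modeField p pphi μ t (X t)).2.2.2 t := (h t ht).snd.snd.snd
    refine (h1.add ((Real.hasDerivAt_log ht0).mul (hψ t ht))).congr_deriv ?_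
    simp only [modeField, Prod.smul_snd, smul_eq_mul]
    field_simp
    ring
  · have h1 := one_add_tauSq_pos p μ ht.1
    simp only [nuOf, lapse]
    field_simp

theorem stateOf_of_state (p : Fin D → ℝ) (X : ℝ → ModeState D) {t : ℝ} (ht : 0 < t) :
    stateOf p (fun t => etaOf p t (X t)) (fun t => (X t).1)
      (fun t => phiOf t (X t)) (fun t => (X t).2.2.1) t = X t := by
  refine Prod.ext rfl (Prod.ext ?_ (Prod.ext rfl ?_))
  · funext i j
    simp only [stateOf, etaOf]
    linear_combination ((X t).2.1 i j - weightInt (2 * p j - 2 * p i) t * (X t).1 i j)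
      * rpow_mul_rpow_swap ht (2 * p j) (2 * p i)
  · simp [stateOf, phiOf]

end Mode

section Bounds

variable {D : ℕ}

theorem abs_fst_apply_le (x : ModeState D) (i j : Fin D) : |x.1 i j| ≤ ‖x‖ :=
  ((norm_le_pi_norm (x.1 i) j).trans (norm_le_pi_norm x.1 i)).trans (norm_fst_le x)

theorem abs_snd_fst_apply_le (x : ModeState D) (i j : Fin D) : |x.2.1 i j| ≤ ‖x‖ :=
  ((norm_le_pi_norm (x.2.1 i) j).trans (norm_le_pi_norm x.2.1 i)).trans
    ((norm_fst_le x.2).trans (norm_snd_le x))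

theorem abs_snd_snd_fst_le (x : ModeState D) : |x.2.2.1| ≤ ‖x‖ :=
  (norm_fst_le x.2.2).trans ((norm_snd_le x.2).trans (norm_snd_le x))

theorem abs_snd_snd_snd_le (x : ModeState D) : |x.2.2.2| ≤ ‖x‖ :=
  (norm_snd_le x.2.2).trans ((norm_snd_le x.2).trans (norm_snd_le x))

/-- The bounds on the exponents, the scalar coefficient and the wave vector under which the
regularized system is regular singular. -/
structure ModeBounds (p : Fin D → ℝ) (pphi : ℝ) (μ : Fin D → ℝ) (δ : ℝ) : Prop where
  delta_pos : 0 < δ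
  subcritical : ∀ i j k : Fin D, j ≠ k → δ ≤ 1 + p i - p j - p k
  le_one_sub : ∀ k, δ ≤ 1 - p k
  abs_p_le : ∀ k, |p k| ≤ 1
  abs_pphi_le : |pphi| ≤ 1
  abs_mu_le : ∀ k, |μ k| ≤ 1

theorem rpow_mul_weights_le {t δ r x y : ℝ} (ht : t ∈ Set.Ioc (0 : ℝ) 1) (h1 : 2 * δ ≤ r)
    (h2 : 2 * δ ≤ r + x) (h3 : 2 * δ ≤ r + y) (h4 : 2 * δ ≤ r + x + y) :
    (1 + t ^ x) * t ^ r * (1 + t ^ y) ≤ 4 * t ^ (2 * δ) := by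
  have e : (1 + t ^ x) * t ^ r * (1 + t ^ y)
      = t ^ r + t ^ (r + x) + t ^ (r + y) + t ^ (r + x + y) := by
    rw [Real.rpow_add ht.1 (r + x), Real.rpow_add ht.1 r x, Real.rpow_add ht.1 r y]
    ring
  have m : ∀ q, 2 * δ ≤ q → t ^ q ≤ t ^ (2 * δ) := fun q hq =>
    Real.rpow_le_rpow_of_exponent_ge ht.1 ht.2 hq
  rw [e]
  linarith [m _ h1, m _ h2, m _ h3, m _ h4]

theorem one_le_one_sub_log {t : ℝ} (ht : t ∈ Set.Ioc (0 : ℝ) 1) : 1 ≤ 1 - Real.log t := by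
  have := Real.log_nonpos ht.1.le ht.2
  linarith

theorem abs_etaOf_le (p : Fin D → ℝ) {t : ℝ} (ht : t ∈ Set.Ioc (0 : ℝ) 1) (x : ModeState D)
    (i j : Fin D) :
    |etaOf p t x i j| ≤ (1 + t ^ (2 * p i - 2 * p j)) * ((1 - Real.log t) * ‖x‖) := by
  have h1 := abs_fst_apply_le x i j
  have h2 := abs_snd_fst_apply_le x i j
  have hw0 := weightInt_nonneg (2 * p j - 2 * p i) ht
  have hw := weightInt_le (2 * p j - 2 * p i) ht
  have hsw := rpow_mul_rpow_swap ht.1 (2 * p i) (2 * p j)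
  have hA := Real.rpow_pos_of_pos ht.1 (2 * p i - 2 * p j)
  have hB := Real.rpow_pos_of_pos ht.1 (2 * p j - 2 * p i)
  have hL := Real.log_nonpos ht.1.le ht.2
  simp only [etaOf, abs_mul, abs_of_pos hA]
  generalize t ^ (2 * p i - 2 * p j) = A at *
  generalize t ^ (2 * p j - 2 * p i) = B at *
  have hN := norm_nonneg x
  calc A * |x.2.1 i j - weightInt (2 * p j - 2 * p i) t * x.1 i j|
      ≤ A * (‖x‖ + (1 + B) * (-Real.log t) * ‖x‖) := by
        refine mul_le_mul_of_nonneg_left ((abs_sub _ _).trans ?_) hA.le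
        rw [abs_mul, abs_of_nonneg hw0]
        have : 0 ≤ (1 + B) * -Real.log t := mul_nonneg (by linarith) (by linarith)
        gcongr
    _ = A * ‖x‖ + (A + A * B) * (-Real.log t) * ‖x‖ := by ring
    _ ≤ _ := by
        rw [hsw]
        nlinarith

theorem abs_mul_etaOf_le {p : Fin D → ℝ} {δ : ℝ} {t : ℝ} (ht : t ∈ Set.Ioc (0 : ℝ) 1)
    (x : ModeState D) {r q c : ℝ} (hc : |c| ≤ 1) (i j : Fin D)
    (hw : (1 + t ^ q) * t ^ r * (1 + t ^ (2 * p i - 2 * p j)) ≤ 4 * t ^ (2 * δ)) :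
    |(1 + t ^ q) * (t ^ r * c * etaOf p t x i j)|
      ≤ 4 * (t ^ (2 * δ) * ((1 - Real.log t) * ‖x‖)) := by
  have h1 := abs_etaOf_le p ht x i j
  have h2 : 0 ≤ (1 - Real.log t) * ‖x‖ :=
    mul_nonneg (zero_le_one.trans (one_le_one_sub_log ht)) (norm_nonneg x)
  have hq := Real.rpow_pos_of_pos ht.1 q
  have hr := Real.rpow_pos_of_pos ht.1 r
  rw [abs_mul, abs_mul, abs_mul, abs_of_pos hr, abs_of_pos (by positivity)]
  calc (1 + t ^ q) * (t ^ r * |c| * |etaOf p t x i j|)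
      ≤ (1 + t ^ q) * (t ^ r * 1 * ((1 + t ^ (2 * p i - 2 * p j)) *
          ((1 - Real.log t) * ‖x‖))) := by gcongr
    _ = ((1 + t ^ q) * t ^ r * (1 + t ^ (2 * p i - 2 * p j))) * ((1 - Real.log t) * ‖x‖) := by ring
    _ ≤ (4 * t ^ (2 * δ)) * ((1 - Real.log t) * ‖x‖) := by gcongr
    _ = _ := by ring

theorem abs_mul_le_one {a b : ℝ} (ha : |a| ≤ 1) (hb : |b| ≤ 1) : |a * b| ≤ 1 := by
  rw [abs_mul]
  exact mul_le_one₀ ha (abs_nonneg b) hb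

theorem abs_sum_le_card_mul {f : Fin D → ℝ} {C : ℝ} (h : ∀ i, |f i| ≤ C) :
    |∑ i, f i| ≤ D * C := by
  refine (Finset.abs_sum_le_sum_abs _ _).trans ((Finset.sum_le_sum fun i _ => h i).trans ?_)
  simp

namespace ModeBounds

variable {p : Fin D → ℝ} {pphi : ℝ} {μ : Fin D → ℝ} {δ : ℝ}

theorem rpow_two_sub_le (h : ModeBounds p pphi μ δ) {t : ℝ} (ht : t ∈ Set.Ioc (0 : ℝ) 1)
    (k : Fin D) : t ^ (2 - 2 * p k) ≤ t ^ (2 * δ) :=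
  Real.rpow_le_rpow_of_exponent_ge ht.1 ht.2 (by linarith [h.le_one_sub k])

theorem tauSq_le (h : ModeBounds p pphi μ δ) {t : ℝ} (ht : t ∈ Set.Ioc (0 : ℝ) 1) :
    tauSq p μ t ≤ D * t ^ (2 * δ) := by
  refine (le_abs_self _).trans (abs_sum_le_card_mul fun k => ?_)
  have h1 := h.rpow_two_sub_le ht k
  have h2 := Real.rpow_pos_of_pos ht.1 (2 - 2 * p k)
  rw [abs_of_nonneg (by positivity)]
  have h3 : μ k ^ 2 ≤ 1 := (sq_le_one_iff_abs_le_one _).2 (h.abs_mu_le k)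
  nlinarith

theorem abs_lapseSource_le (h : ModeBounds p pphi μ δ) {t : ℝ} (ht : t ∈ Set.Ioc (0 : ℝ) 1)
    (x : ModeState D) :
    |lapseSource p μ t (etaOf p t x)|
      ≤ 8 * D ^ 2 * (t ^ (2 * δ) * ((1 - Real.log t) * ‖x‖)) := by
  have hm := h.abs_mu_le
  have e : lapseSource p μ t (etaOf p t x)
      = ∑ k, ∑ a, ((1 + t ^ (0 : ℝ)) * (t ^ (2 - 2 * p k) * (μ k * μ k) * etaOf p t x a a)
        - (1 + t ^ (0 : ℝ)) * (t ^ (2 - 2 * p k) * (μ k * μ a) * etaOf p t x k a)) := by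
    simp only [lapseSource, tauSq, contraction, Real.rpow_zero, Finset.sum_sub_distrib,
      Finset.mul_sum, Finset.sum_mul]
    congr 1
    · rw [Finset.sum_comm]
      exact Finset.sum_congr rfl fun k _ => Finset.sum_congr rfl fun a _ => by ring
    · exact Finset.sum_congr rfl fun k _ => Finset.sum_congr rfl fun a _ => by ring
  rw [e]
  have := abs_sum_le_card_mul (D := D) fun k => abs_sum_le_card_mul (D := D)
    (f := fun a => ((1 + t ^ (0 : ℝ)) * (t ^ (2 - 2 * p k) * (μ k * μ k) * etaOf p t x a a)
        - (1 + t ^ (0 : ℝ)) * (t ^ (2 - 2 * p k) * (μ k * μ a) * etaOf p t x k a)))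
    (C := 8 * (t ^ (2 * δ) * ((1 - Real.log t) * ‖x‖))) fun a => by
      have hk := h.le_one_sub k
      have ha := h.le_one_sub a
      have h1 := abs_mul_etaOf_le (p := p) (δ := δ) (q := 0) (r := 2 - 2 * p k) ht x
        (abs_mul_le_one (hm k) (hm k)) a a
        (rpow_mul_weights_le ht (by linarith) (by linarith) (by linarith) (by linarith))
      have h2 := abs_mul_etaOf_le (p := p) (δ := δ) (q := 0) (r := 2 - 2 * p k) ht x
        (abs_mul_le_one (hm k) (hm a)) k a
        (rpow_mul_weights_le ht (by linarith) (by linarith) (by linarith) (by linarith))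
      refine (abs_sub _ _).trans ?_
      linarith
  refine this.trans (le_of_eq ?_)
  ring

theorem abs_nuOf_le (h : ModeBounds p pphi μ δ) {t : ℝ} (ht : t ∈ Set.Ioc (0 : ℝ) 1)
    (x : ModeState D) :
    |nuOf p μ t x| ≤ 8 * D ^ 2 * (t ^ (2 * δ) * ((1 - Real.log t) * ‖x‖)) := by
  have h1 := tauSq_nonneg p μ ht.1
  rw [nuOf, lapse, abs_div, abs_of_pos (one_add_tauSq_pos p μ ht.1)]
  exact (div_le_self (abs_nonneg _) (by linarith)).trans (h.abs_lapseSource_le ht x)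

/-- The singular contributions to the source of `κ` cancel. -/
theorem kapSource_eq (p μ : Fin D → ℝ) (t : ℝ) (h : Fin D → Fin D → ℝ) (n : ℝ) (i j : Fin D) :
    kapSource p μ t h n i j =
      (∑ k, t ^ (2 - 2 * p k) *
        (μ k * μ k * (-1 + (if k = i then 1 else 0) + (if k = j then 1 else 0))) * h i j)
      + (∑ a, t ^ (2 - 2 * p a) * (μ i * μ a * (if a = i then 0 else 1)) * h a j)
      + (∑ b, t ^ (2 - 2 * p j) * (μ j * μ b * (if b = j then 0 else 1)) * h i b)
      - (∑ a, t ^ (2 - 2 * p j) * (μ i * μ j) * h a a)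
      + t ^ (2 - 2 * p j) * (μ i * μ j) * n
      + p i * (if i = j then 1 else 0) * n := by
  have e1 : (∑ k, t ^ (2 - 2 * p k) *
        (μ k * μ k * (-1 + (if k = i then 1 else 0) + (if k = j then 1 else 0))) * h i j)
      = -(tauSq p μ t) * h i j + t ^ (2 - 2 * p i) * (μ i * μ i) * h i j
        + t ^ (2 - 2 * p j) * (μ j * μ j) * h i j := by
    have : ∀ k, t ^ (2 - 2 * p k) *
        (μ k * μ k * (-1 + (if k = i then 1 else 0) + (if k = j then 1 else 0))) * h i j
        = -(t ^ (2 - 2 * p k) * μ k ^ 2) * h i j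
          + (if k = i then t ^ (2 - 2 * p k) * (μ k * μ k) * h i j else 0)
          + (if k = j then t ^ (2 - 2 * p k) * (μ k * μ k) * h i j else 0) := by
      intro k
      split_ifs <;> ring
    simp only [this, Finset.sum_add_distrib, Finset.sum_ite_eq', Finset.mem_univ, if_true,
      ← Finset.sum_mul, Finset.sum_neg_distrib, tauSq]
  have e2 : (∑ a, t ^ (2 - 2 * p a) * (μ i * μ a * (if a = i then 0 else 1)) * h a j)
      = (∑ a, t ^ (2 - 2 * p a) * μ i * μ a * h a j)
        - t ^ (2 - 2 * p i) * (μ i * μ i) * h i j := by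
    have : ∀ a, t ^ (2 - 2 * p a) * (μ i * μ a * (if a = i then 0 else 1)) * h a j
        = t ^ (2 - 2 * p a) * μ i * μ a * h a j
          - (if a = i then t ^ (2 - 2 * p a) * (μ i * μ a) * h a j else 0) := by
      intro k
      split_ifs <;> ring
    simp only [this, Finset.sum_sub_distrib, Finset.sum_ite_eq', Finset.mem_univ, if_true]
  have e3 : (∑ b, t ^ (2 - 2 * p j) * (μ j * μ b * (if b = j then 0 else 1)) * h i b)
      = t ^ (2 - 2 * p j) * μ j * (∑ b, μ b * h i b)
        - t ^ (2 - 2 * p j) * (μ j * μ j) * h i j := by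
    have : ∀ b, t ^ (2 - 2 * p j) * (μ j * μ b * (if b = j then 0 else 1)) * h i b
        = t ^ (2 - 2 * p j) * μ j * (μ b * h i b)
          - (if b = j then t ^ (2 - 2 * p j) * (μ j * μ b) * h i b else 0) := by
      intro k
      split_ifs <;> ring
    simp only [this, Finset.sum_sub_distrib, Finset.sum_ite_eq', Finset.mem_univ, if_true,
      Finset.mul_sum]
  rw [e1, e2, e3, ← Finset.mul_sum, kapSource]
  ring

theorem abs_kapField_le (h : ModeBounds p pphi μ δ) {t : ℝ} (ht : t ∈ Set.Ioc (0 : ℝ) 1)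
    (x : ModeState D) (i j : Fin D) :
    (1 + t ^ (2 * p j - 2 * p i)) * |kapField p μ t x i j|
      ≤ (16 * D + 48 * D ^ 2) * (t ^ (2 * δ) * ((1 - Real.log t) * ‖x‖)) := by
  have hm := h.abs_mu_le
  have hδ := h.delta_pos
  have hi := h.le_one_sub i
  have hj := h.le_one_sub j
  have hν := h.abs_nuOf_le ht x
  have hw0 := Real.rpow_pos_of_pos ht.1 (2 * p j - 2 * p i)
  set R := t ^ (2 * δ) * ((1 - Real.log t) * ‖x‖) with hR
  set w := 1 + t ^ (2 * p j - 2 * p i) with hw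
  have hwp : 0 < w := by positivity
  have b1 : ∀ k, |w * (t ^ (2 - 2 * p k) *
      (μ k * μ k * (-1 + (if k = i then 1 else 0) + (if k = j then 1 else 0)))
        * etaOf p t x i j)| ≤ 4 * R := by
    intro k
    have hk := h.le_one_sub k
    have hR0 : 0 ≤ R := by
      have := one_le_one_sub_log ht
      have := Real.rpow_pos_of_pos ht.1 (2 * δ)
      positivity
    by_cases hki : k = i
    · by_cases hkj : k = j
      · subst hki
        subst hkj
        refine abs_mul_etaOf_le ht x (abs_mul_le_one (abs_mul_le_one (hm k) (hm k)) (by simp)) _ _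
          (rpow_mul_weights_le ht ?_ ?_ ?_ ?_) <;> linarith
      · simp [hki, show i ≠ j from fun e => hkj (hki.trans e), hR0]
    · by_cases hkj : k = j
      · simp [hkj, show j ≠ i from fun e => hki (hkj.trans e), hR0]
      · refine abs_mul_etaOf_le ht x (abs_mul_le_one (abs_mul_le_one (hm k) (hm k))
          (by simp [hki, hkj])) _ _ (rpow_mul_weights_le ht ?_ ?_ ?_ ?_)
        · linarith
        · linarith [h.subcritical j k i hki]
        · linarith [h.subcritical i k j hkj]
        · linarith
  have b2 : ∀ a, |w * (t ^ (2 - 2 * p a) * (μ i * μ a * (if a = i then 0 else 1))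
      * etaOf p t x a j)| ≤ 4 * R := by
    intro a
    have ha := h.le_one_sub a
    by_cases hai : a = i
    · have hR0 : 0 ≤ R := by
        have := one_le_one_sub_log ht
        have := Real.rpow_pos_of_pos ht.1 (2 * δ)
        positivity
      simp [hai, hR0]
    · refine abs_mul_etaOf_le ht x (abs_mul_le_one (abs_mul_le_one (hm i) (hm a)) (by simp [hai]))
        _ _ (rpow_mul_weights_le ht ?_ ?_ ?_ ?_)
      · linarith
      · linarith [h.subcritical j a i hai]
      · linarith
      · linarith
  have b3 : ∀ b, |w * (t ^ (2 - 2 * p j) * (μ j * μ b * (if b = j then 0 else 1))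
      * etaOf p t x i b)| ≤ 4 * R := by
    intro b
    have hb := h.le_one_sub b
    by_cases hbj : b = j
    · have hR0 : 0 ≤ R := by
        have := one_le_one_sub_log ht
        have := Real.rpow_pos_of_pos ht.1 (2 * δ)
        positivity
      simp [hbj, hR0]
    · refine abs_mul_etaOf_le ht x (abs_mul_le_one (abs_mul_le_one (hm j) (hm b)) (by simp [hbj]))
        _ _ (rpow_mul_weights_le ht ?_ ?_ ?_ ?_)
      · linarith
      · linarith
      · linarith [h.subcritical i b j hbj]
      · linarith
  have b4 : ∀ a, |w * (t ^ (2 - 2 * p j) * (μ i * μ j) * etaOf p t x a a)| ≤ 4 * R := by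
    intro a
    refine abs_mul_etaOf_le ht x (abs_mul_le_one (hm i) (hm j)) _ _
        (rpow_mul_weights_le ht ?_ ?_ ?_ ?_) <;> linarith
  have hT : ∀ r : ℝ, 0 ≤ r → t ^ r ≤ 1 := fun r hr => Real.rpow_le_one ht.1.le ht.2 hr
  have b5 : |w * (t ^ (2 - 2 * p j) * (μ i * μ j) * nuOf p μ t x)| ≤ 16 * D ^ 2 * R := by
    have h1 : w * t ^ (2 - 2 * p j) ≤ 2 := by
      have : w * t ^ (2 - 2 * p j) = t ^ (2 - 2 * p j) + t ^ (2 - 2 * p i) := by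
        rw [hw, add_mul, one_mul, ← Real.rpow_add ht.1]
        ring_nf
      rw [this]
      linarith [hT (2 - 2 * p j) (by linarith), hT (2 - 2 * p i) (by linarith)]
    have h2 := abs_mul_le_one (hm i) (hm j)
    have h3 := Real.rpow_pos_of_pos ht.1 (2 - 2 * p j)
    rw [abs_mul, abs_mul, abs_mul, abs_of_pos hwp, abs_of_pos h3]
    calc _ = (w * t ^ (2 - 2 * p j)) * |μ i * μ j| * |nuOf p μ t x| := by ring
      _ ≤ 2 * 1 * (8 * D ^ 2 * R) := by gcongr
      _ = _ := by ring
  have b6 : |w * (p i * (if i = j then 1 else 0) * nuOf p μ t x)| ≤ 16 * D ^ 2 * R := by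
    by_cases hij : i = j
    · have h1 : w = 2 := by rw [hw, hij]; norm_num
      rw [h1, abs_mul, abs_mul]
      simp only [hij, if_true, mul_one]
      have := h.abs_p_le j
      calc _ ≤ |(2 : ℝ)| * (1 * (8 * D ^ 2 * R)) := by gcongr
        _ = _ := by rw [abs_of_pos two_pos]; ring
    · simp only [hij, if_false, mul_zero, zero_mul, abs_zero]
      have := abs_nonneg (nuOf p μ t x)
      linarith
  rw [← abs_of_pos hwp, ← abs_mul, kapField, kapSource_eq, mul_add, mul_add, mul_sub,
    mul_add, mul_add, Finset.mul_sum, Finset.mul_sum, Finset.mul_sum, Finset.mul_sum]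
  have s1 := abs_le.1 (abs_sum_le_card_mul b1)
  have s2 := abs_le.1 (abs_sum_le_card_mul b2)
  have s3 := abs_le.1 (abs_sum_le_card_mul b3)
  have s4 := abs_le.1 (abs_sum_le_card_mul b4)
  have s5 := abs_le.1 b5
  have s6 := abs_le.1 b6
  have hR0 : 0 ≤ (D : ℝ) ^ 2 * R := by
    have := abs_nonneg (nuOf p μ t x)
    linarith
  rw [abs_le]
  constructor <;> linarith [s1.1, s1.2, s2.1, s2.2, s3.1, s3.2, s4.1, s4.2, s5.1, s5.2, s6.1, s6.2]

theorem abs_phiOf_le {t : ℝ} (ht : t ∈ Set.Ioc (0 : ℝ) 1) (x : ModeState D) :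
    |phiOf t x| ≤ (1 - Real.log t) * ‖x‖ := by
  have h1 := abs_snd_snd_fst_le x
  have h2 := abs_snd_snd_snd_le x
  have h3 := Real.log_nonpos ht.1.le ht.2
  refine (abs_add_le _ _).trans ?_
  rw [abs_mul, abs_of_nonpos h3]
  nlinarith [norm_nonneg x, mul_le_mul_of_nonneg_left h1 (neg_nonneg.2 h3)]

theorem abs_psiField_le (h : ModeBounds p pphi μ δ) {t : ℝ} (ht : t ∈ Set.Ioc (0 : ℝ) 1)
    (x : ModeState D) :
    |psiField p pphi μ t x| ≤ (D + 8 * D ^ 2) * (t ^ (2 * δ) * ((1 - Real.log t) * ‖x‖)) := by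
  have hν := h.abs_nuOf_le ht x
  have hφ := abs_phiOf_le ht x
  have hτ := h.tauSq_le ht
  have hτ0 := tauSq_nonneg p μ ht.1
  have hp := h.abs_pphi_le
  have hP := Real.rpow_pos_of_pos ht.1 (2 * δ)
  rw [psiField]
  refine (abs_sub _ _).trans ?_
  rw [abs_mul, abs_mul, abs_neg, abs_of_nonneg hτ0]
  calc _ ≤ (D * t ^ (2 * δ)) * ((1 - Real.log t) * ‖x‖)
        + 1 * (8 * D ^ 2 * (t ^ (2 * δ) * ((1 - Real.log t) * ‖x‖))) := by gcongr
    _ = _ := by ring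

theorem one_sub_log_le (hδ : 0 < δ) {t : ℝ} (ht : t ∈ Set.Ioc (0 : ℝ) 1) :
    t ^ (2 * δ) * (1 - Real.log t) ^ 2 ≤ (1 + 2 / δ) ^ 2 * t ^ δ := by
  have h1 := Real.log_le_rpow_div (x := t⁻¹) (inv_nonneg.2 ht.1.le) (half_pos hδ)
  rw [Real.log_inv, Real.inv_rpow ht.1.le, ← Real.rpow_neg ht.1.le] at h1
  have hq : 1 ≤ t ^ (-(δ / 2)) :=
    Real.one_le_rpow_of_pos_of_le_one_of_nonpos ht.1 ht.2 (by linarith)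
  have h2 : 1 - Real.log t ≤ (1 + 2 / δ) * t ^ (-(δ / 2)) := by
    have : t ^ (-(δ / 2)) / (δ / 2) = 2 / δ * t ^ (-(δ / 2)) := by field_simp
    linarith
  have h3 := one_le_one_sub_log ht
  have hP := Real.rpow_pos_of_pos ht.1 (2 * δ)
  calc _ ≤ t ^ (2 * δ) * ((1 + 2 / δ) * t ^ (-(δ / 2))) ^ 2 := by gcongr
    _ = (1 + 2 / δ) ^ 2 * (t ^ (2 * δ) * (t ^ (-(δ / 2)) * t ^ (-(δ / 2)))) := by ring
    _ = _ := by
      rw [← Real.rpow_add ht.1, ← Real.rpow_add ht.1]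
      ring_nf

theorem norm_modeField_le (h : ModeBounds p pphi μ δ) {t : ℝ} (ht : t ∈ Set.Ioc (0 : ℝ) 1)
    (x : ModeState D) :
    ‖modeField p pphi μ t x‖ ≤ (17 * D + 56 * D ^ 2) * (1 + 2 / δ) ^ 2 * t ^ δ * ‖x‖ := by
  have hL := one_le_one_sub_log ht
  have hl := Real.log_nonpos ht.1.le ht.2
  have hN := norm_nonneg x
  have hP := Real.rpow_pos_of_pos ht.1 (2 * δ)
  have hν := h.abs_nuOf_le ht x
  have hψ := h.abs_psiField_le ht x
  have hp := h.abs_pphi_le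
  set R := t ^ (2 * δ) * ((1 - Real.log t) * ‖x‖) with hR
  have hR0 : 0 ≤ R := by positivity
  have hfin : (17 * D + 56 * D ^ 2) * ((1 - Real.log t) * R)
      ≤ (17 * D + 56 * D ^ 2) * (1 + 2 / δ) ^ 2 * t ^ δ * ‖x‖ := by
    have h1 := one_sub_log_le h.delta_pos ht
    calc _ = (17 * D + 56 * D ^ 2) * (t ^ (2 * δ) * (1 - Real.log t) ^ 2) * ‖x‖ := by
          rw [hR]; ring
      _ ≤ (17 * D + 56 * D ^ 2) * ((1 + 2 / δ) ^ 2 * t ^ δ) * ‖x‖ := by gcongr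
      _ = _ := by ring
  have hRL : R ≤ (1 - Real.log t) * R := le_mul_of_one_le_left hR0 hL
  have hlR : 0 ≤ -Real.log t * R := mul_nonneg (by linarith) hR0
  have hD0 : (0 : ℝ) ≤ D := Nat.cast_nonneg D
  have hkap : ∀ i j, |kapField p μ t x i j| ≤ (16 * D + 48 * D ^ 2) * R := fun i j => by
    have h1 := h.abs_kapField_le ht x i j
    have h2 := Real.rpow_pos_of_pos ht.1 (2 * p j - 2 * p i)
    have h3 := abs_nonneg (kapField p μ t x i j)
    nlinarith
  refine le_trans ?_ hfin
  have hB0 : 0 ≤ (17 * D + 56 * D ^ 2) * ((1 - Real.log t) * R) := by positivity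
  have step : ∀ c : ℝ, 0 ≤ c → c ≤ 17 * D + 56 * D ^ 2 →
      c * R ≤ (17 * D + 56 * D ^ 2) * ((1 - Real.log t) * R) := fun c hc0 hc => by gcongr
  refine norm_prod_le_iff.2 ⟨?_, norm_prod_le_iff.2 ⟨?_, norm_prod_le_iff.2 ⟨?_, ?_⟩⟩⟩
  · refine (pi_norm_le_iff_of_nonneg hB0).2 fun i => (pi_norm_le_iff_of_nonneg hB0).2 fun j => ?_
    exact (hkap i j).trans (step _ (by positivity) (by nlinarith))
  · refine (pi_norm_le_iff_of_nonneg hB0).2 fun i => (pi_norm_le_iff_of_nonneg hB0).2 fun j => ?_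
    have hw0 := weightInt_nonneg (2 * p j - 2 * p i) ht
    have hw := weightInt_le (2 * p j - 2 * p i) ht
    have h1 := h.abs_kapField_le ht x i j
    have h2 : |weightInt (2 * p j - 2 * p i) t * kapField p μ t x i j|
        ≤ (-Real.log t) * ((16 * D + 48 * D ^ 2) * R) := by
      rw [abs_mul, abs_of_nonneg hw0]
      calc _ ≤ ((1 + t ^ (2 * p j - 2 * p i)) * (-Real.log t)) * |kapField p μ t x i j| := by gcongr
        _ = (-Real.log t) * ((1 + t ^ (2 * p j - 2 * p i)) * |kapField p μ t x i j|) := by ring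
        _ ≤ _ := by
          have : 0 ≤ -Real.log t := by linarith
          gcongr
    have h3 : |-(p i * (if i = j then 1 else 0) * nuOf p μ t x)| ≤ 8 * D ^ 2 * R := by
      rw [abs_neg, abs_mul]
      have : |p i * (if i = j then 1 else 0)| ≤ 1 :=
        abs_mul_le_one (h.abs_p_le i) (by split_ifs <;> simp)
      calc _ ≤ 1 * (8 * D ^ 2 * R) := by gcongr
        _ = _ := one_mul _
    refine (abs_add_le _ _).trans ?_
    have := mul_nonneg hD0 hR0
    have := mul_nonneg hD0 hlR
    have := mul_nonneg (mul_nonneg hD0 hD0) hlR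
    nlinarith
  · exact hψ.trans (step _ (by positivity) (by nlinarith))
  · refine (abs_sub _ _).trans ?_
    rw [abs_mul, abs_mul, abs_of_nonpos hl]
    have h1 : |pphi| * |nuOf p μ t x| ≤ 1 * (8 * D ^ 2 * R) := by gcongr
    have h2 : -Real.log t * |psiField p pphi μ t x| ≤ -Real.log t * ((D + 8 * D ^ 2) * R) := by
      have : 0 ≤ -Real.log t := by linarith
      gcongr
    have := mul_nonneg hD0 hR0
    have := mul_nonneg hD0 hlR
    have := mul_nonneg (mul_nonneg hD0 hD0) hlR
    nlinarith

end ModeBounds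

end Bounds

section Solve

variable {D : ℕ}

theorem etaOf_sub (p : Fin D → ℝ) (t : ℝ) (x y : ModeState D) :
    etaOf p t (x - y) = etaOf p t x - etaOf p t y := by
  funext i j
  simp only [etaOf, Prod.fst_sub, Prod.snd_sub, Pi.sub_apply]
  ring

theorem lapseSource_sub (p μ : Fin D → ℝ) (t : ℝ) (h k : Fin D → Fin D → ℝ) :
    lapseSource p μ t (h - k) = lapseSource p μ t h - lapseSource p μ t k := by
  simp only [lapseSource, contraction, Pi.sub_apply, mul_sub, Finset.sum_sub_distrib]
  ring

theorem nuOf_sub (p μ : Fin D → ℝ) (t : ℝ) (x y : ModeState D) :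
    nuOf p μ t (x - y) = nuOf p μ t x - nuOf p μ t y := by
  simp only [nuOf, lapse, etaOf_sub, lapseSource_sub, sub_div]

theorem kapField_sub (p μ : Fin D → ℝ) (t : ℝ) (x y : ModeState D) (i j : Fin D) :
    kapField p μ t (x - y) i j = kapField p μ t x i j - kapField p μ t y i j := by
  simp only [kapField, kapSource, nuOf_sub, etaOf_sub, Pi.sub_apply, mul_sub,
    Finset.sum_sub_distrib]
  ring

theorem psiField_sub (p : Fin D → ℝ) (pphi : ℝ) (μ : Fin D → ℝ) (t : ℝ) (x y : ModeState D) :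
    psiField p pphi μ t (x - y) = psiField p pphi μ t x - psiField p pphi μ t y := by
  simp only [psiField, phiOf, nuOf_sub, Prod.snd_sub, Prod.fst_sub]
  ring

theorem modeField_sub (p : Fin D → ℝ) (pphi : ℝ) (μ : Fin D → ℝ) (t : ℝ) (x y : ModeState D) :
    modeField p pphi μ t (x - y) = modeField p pphi μ t x - modeField p pphi μ t y := by
  refine Prod.ext ?_ (Prod.ext ?_ (Prod.ext (psiField_sub p pphi μ t x y) ?_))
  · funext i j
    exact kapField_sub p μ t x y i j
  · funext i j
    simp only [modeField, kapField_sub, nuOf_sub, Prod.snd_sub, Prod.fst_sub, Pi.sub_apply]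
    ring
  · simp only [modeField, psiField_sub, nuOf_sub, Prod.snd_sub]
    ring

theorem modeField_zero (p : Fin D → ℝ) (pphi : ℝ) (μ : Fin D → ℝ) (t : ℝ) :
    modeField p pphi μ t 0 = 0 := by
  simpa using modeField_sub p pphi μ t 0 0

section Continuity

variable (p : Fin D → ℝ) (μ : Fin D → ℝ)

theorem continuousOn_fst_rpow (q : ℝ) :
    ContinuousOn (fun z : ℝ × ModeState D => z.1 ^ q) (Set.Ioc 0 1 ×ˢ Set.univ) := fun z hz =>
  ((Real.continuousAt_rpow_const z.1 q (Or.inl hz.1.1.ne')).comp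
    continuousAt_fst).continuousWithinAt

theorem continuousOn_fst_weightInt (q : ℝ) :
    ContinuousOn (fun z : ℝ × ModeState D => weightInt q z.1) (Set.Ioc 0 1 ×ˢ Set.univ) :=
  fun _ hz => ((hasDerivAt_weightInt q hz.1.1).continuousAt.comp
    (f := fun z : ℝ × ModeState D => z.1) continuousAt_fst).continuousWithinAt

theorem continuousOn_fst_log :
    ContinuousOn (fun z : ℝ × ModeState D => Real.log z.1) (Set.Ioc 0 1 ×ˢ Set.univ) :=
  fun _ hz => (continuousAt_fst.log hz.1.1.ne').continuousWithinAt

theorem continuousOn_etaOf (i j : Fin D) :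
    ContinuousOn (fun z : ℝ × ModeState D => etaOf p z.1 z.2 i j) (Set.Ioc 0 1 ×ˢ Set.univ) :=
  (continuousOn_fst_rpow _).mul (ContinuousOn.sub (by fun_prop)
    ((continuousOn_fst_weightInt _).mul (by fun_prop)))

theorem continuousOn_tauSq :
    ContinuousOn (fun z : ℝ × ModeState D => tauSq p μ z.1) (Set.Ioc 0 1 ×ˢ Set.univ) :=
  continuousOn_finsetSum _ fun _ _ => (continuousOn_fst_rpow _).mul continuousOn_const

theorem continuousOn_nuOf :
    ContinuousOn (fun z : ℝ × ModeState D => nuOf p μ z.1 z.2) (Set.Ioc 0 1 ×ˢ Set.univ) := by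
  have hη := continuousOn_etaOf p
  have hτ := continuousOn_tauSq p μ
  have hr := fun q => continuousOn_fst_rpow (D := D) q
  refine ContinuousOn.div ?_ (continuousOn_const.add hτ)
    fun _ hz => (one_add_tauSq_pos p μ hz.1.1).ne'
  unfold lapseSource contraction
  fun_prop

theorem continuousOn_kapField (i j : Fin D) :
    ContinuousOn (fun z : ℝ × ModeState D => kapField p μ z.1 z.2 i j)
      (Set.Ioc 0 1 ×ˢ Set.univ) := by
  have hη := continuousOn_etaOf p
  have hτ := continuousOn_tauSq p μ
  have hν := continuousOn_nuOf p μ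
  have hr := fun q => continuousOn_fst_rpow (D := D) q
  unfold kapField kapSource
  fun_prop

theorem continuousOn_psiField (pphi : ℝ) :
    ContinuousOn (fun z : ℝ × ModeState D => psiField p pphi μ z.1 z.2)
      (Set.Ioc 0 1 ×ˢ Set.univ) := by
  have hτ := continuousOn_tauSq p μ
  have hν := continuousOn_nuOf p μ
  have hl := continuousOn_fst_log (D := D)
  unfold psiField phiOf
  fun_prop

theorem continuousOn_modeField (pphi : ℝ) :
    ContinuousOn (Function.uncurry (modeField p pphi μ)) (Set.Ioc 0 1 ×ˢ Set.univ) := by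
  have hκ := continuousOn_kapField p μ
  have hν := continuousOn_nuOf p μ
  have hψ := continuousOn_psiField p μ pphi
  have hl := continuousOn_fst_log (D := D)
  have hw := fun q => continuousOn_fst_weightInt (D := D) q
  refine ContinuousOn.prodMk (continuousOn_pi.2 fun i => continuousOn_pi.2 fun j => hκ i j)
    (ContinuousOn.prodMk (continuousOn_pi.2 fun i => continuousOn_pi.2 fun j => ?_)
      (ContinuousOn.prodMk hψ ?_)) <;> fun_prop

end Continuity

/-- The constant in the bound on the regularized vector field. -/
noncomputable def fieldConst (D : ℕ) (δ : ℝ) : ℝ := (17 * D + 56 * D ^ 2) * (1 + 2 / δ) ^ 2 + 1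

namespace ModeBounds

variable {p : Fin D → ℝ} {pphi : ℝ} {μ : Fin D → ℝ} {δ : ℝ}

theorem fieldConst_pos (hδ : 0 < δ) : 0 < fieldConst D δ := by
  unfold fieldConst
  positivity

theorem norm_modeField_le_fieldConst (h : ModeBounds p pphi μ δ) {t : ℝ}
    (ht : t ∈ Set.Ioc (0 : ℝ) 1) (x : ModeState D) :
    ‖modeField p pphi μ t x‖ ≤ fieldConst D δ * t ^ δ * ‖x‖ := by
  refine (h.norm_modeField_le ht x).trans ?_
  have := Real.rpow_pos_of_pos ht.1 δ
  unfold fieldConst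
  gcongr
  linarith

theorem exists_hasDerivAt (h : ModeBounds p pphi μ δ) (x₀ : ModeState D) :
    ∃ X : ℝ → ModeState D, Tendsto X (𝓝[>] 0) (𝓝 x₀) ∧
      ∀ t ∈ Set.Ioc (0 : ℝ) 1, HasDerivAt X (t⁻¹ • modeField p pphi μ t (X t)) t := by
  refine exists_hasDerivAt_of_singular (C := fieldConst D δ) (half_pos h.delta_pos)
    (fieldConst_pos h.delta_pos)
    (continuousOn_modeField p μ pphi) (fun t ht x y => ?_)
    (fun t _ => modeField_zero p pphi μ t) x₀
  rw [← modeField_sub, mul_div_cancel₀ _ two_ne_zero]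
  exact h.norm_modeField_le_fieldConst ht _

theorem norm_le (h : ModeBounds p pphi μ δ) {X : ℝ → ModeState D} {x₀ : ModeState D}
    (hX : ∀ t ∈ Set.Ioc (0 : ℝ) 1, HasDerivAt X (t⁻¹ • modeField p pphi μ t (X t)) t)
    (hx₀ : Tendsto X (𝓝[>] 0) (𝓝 x₀)) {t : ℝ} (ht : t ∈ Set.Ioc (0 : ℝ) 1) :
    ‖X t‖ ≤ Real.exp (fieldConst D δ / δ) * ‖x₀‖ :=
  norm_le_of_singular h.delta_pos (fieldConst_pos h.delta_pos) hX
    (fun _ hs => h.norm_modeField_le_fieldConst hs _) hx₀ t ht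

theorem eq_of_tendsto (h : ModeBounds p pphi μ δ) {X Y : ℝ → ModeState D} {x₀ : ModeState D}
    (hX : ∀ t ∈ Set.Ioc (0 : ℝ) 1, HasDerivAt X (t⁻¹ • modeField p pphi μ t (X t)) t)
    (hY : ∀ t ∈ Set.Ioc (0 : ℝ) 1, HasDerivAt Y (t⁻¹ • modeField p pphi μ t (Y t)) t)
    (hX₀ : Tendsto X (𝓝[>] 0) (𝓝 x₀)) (hY₀ : Tendsto Y (𝓝[>] 0) (𝓝 x₀))
    {t : ℝ} (ht : t ∈ Set.Ioc (0 : ℝ) 1) : X t = Y t := by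
  have h1 : ‖(X - Y) t‖ ≤ Real.exp (fieldConst D δ / δ) * ‖x₀ - x₀‖ :=
    h.norm_le (fun s hs => by
      rw [modeField_sub, smul_sub]
      exact (hX s hs).sub (hY s hs)) (hX₀.sub hY₀) ht
  rw [sub_self, norm_zero, mul_zero, norm_le_zero_iff] at h1
  exact sub_eq_zero.1 h1

end ModeBounds

/-- A mode is determined by the limit of its regularized unknowns at the singularity. -/
theorem IsModeEvolution.eq_of_tendsto {p : Fin D → ℝ} {pphi : ℝ} {μ : Fin D → ℝ} {δ : ℝ}
    (hb : ModeBounds p pphi μ δ) {η κ η' κ' : ℝ → Fin D → Fin D → ℝ} {φ ψ ν φ' ψ' ν' : ℝ → ℝ}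
    (h : IsModeEvolution p pphi μ η κ φ ψ ν 1) (h' : IsModeEvolution p pphi μ η' κ' φ' ψ' ν' 1)
    {x₀ : ModeState D} (hx : Tendsto (stateOf p η κ φ ψ) (𝓝[>] 0) (𝓝 x₀))
    (hx' : Tendsto (stateOf p η' κ' φ' ψ') (𝓝[>] 0) (𝓝 x₀)) {t : ℝ}
    (ht : t ∈ Set.Ioc (0 : ℝ) 1) :
    η t = η' t ∧ κ t = κ' t ∧ φ t = φ' t ∧ ψ t = ψ' t ∧ ν t = ν' t := by
  have e := hb.eq_of_tendsto (fun s hs => h.hasDerivAt_stateOf hs)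
    (fun s hs => h'.hasDerivAt_stateOf hs) hx hx' ht
  refine ⟨?_, congrArg Prod.fst e, ?_, congrArg (fun x => x.2.2.1) e, ?_⟩
  · rw [← etaOf_stateOf p η κ φ ψ ht.1, e, etaOf_stateOf p η' κ' φ' ψ' ht.1]
  · rw [← phiOf_stateOf p η κ φ ψ t, e, phiOf_stateOf]
  · rw [← h.nuOf_stateOf ht, e, h'.nuOf_stateOf ht]

end Solve

section Symmetry

variable {D : ℕ} {p : Fin D → ℝ} {pphi : ℝ} {μ : Fin D → ℝ} {δ : ℝ}

/-- The transpose of the metric perturbation with respect to the background metric. -/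
noncomputable def etaTranspose (p : Fin D → ℝ) (η : ℝ → Fin D → Fin D → ℝ) (t : ℝ)
    (a c : Fin D) : ℝ :=
  t ^ (2 * p a - 2 * p c) * η t c a

/-- The transpose of the perturbation of the second fundamental form, corrected so that the
evolution equations are equivariant. -/
noncomputable def kapTranspose (p : Fin D → ℝ) (η κ : ℝ → Fin D → Fin D → ℝ) (t : ℝ)
    (a c : Fin D) : ℝ :=
  t ^ (2 * p a - 2 * p c) * (κ t c a + 2 * (p c - p a) * η t c a)

theorem contraction_transpose (p μ : Fin D → ℝ) {t : ℝ} (ht : 0 < t)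
    (η : ℝ → Fin D → Fin D → ℝ) :
    contraction p μ t (etaTranspose p η t) = contraction p μ t (η t) := by
  rw [contraction, contraction, Finset.sum_comm]
  refine Finset.sum_congr rfl fun a _ => Finset.sum_congr rfl fun i _ => ?_
  have ha := (Real.rpow_pos_of_pos ht (2 * p a)).ne'
  have hi := (Real.rpow_pos_of_pos ht (2 * p i)).ne'
  simp only [etaTranspose, Real.rpow_sub ht]
  field_simp

theorem sum_etaTranspose_diag (p : Fin D → ℝ) (η : ℝ → Fin D → Fin D → ℝ) (t : ℝ) :
    ∑ a, etaTranspose p η t a a = ∑ a, η t a a := by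
  simp [etaTranspose]

theorem lapseSource_transpose (p μ : Fin D → ℝ) {t : ℝ} (ht : 0 < t)
    (η : ℝ → Fin D → Fin D → ℝ) :
    lapseSource p μ t (etaTranspose p η t) = lapseSource p μ t (η t) := by
  rw [lapseSource, lapseSource, contraction_transpose p μ ht, sum_etaTranspose_diag]

theorem kapSource_transpose (p μ : Fin D → ℝ) {t : ℝ} (ht : 0 < t)
    (η : ℝ → Fin D → Fin D → ℝ) (n : ℝ) (a c : Fin D) :
    kapSource p μ t (etaTranspose p η t) n a c
      = t ^ (2 * p a - 2 * p c) * kapSource p μ t (η t) n c a := by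
  have hw := fun k => (Real.rpow_pos_of_pos ht (2 * p k)).ne'
  have e3 : (∑ b, t ^ (2 - 2 * p b) * μ a * μ b * etaTranspose p η t b c)
      = t ^ (2 * p a - 2 * p c) * (t ^ (2 - 2 * p a) * μ a * (∑ b, μ b * η t c b)) := by
    simp only [Finset.mul_sum]
    refine Finset.sum_congr rfl fun b _ => ?_
    have ha := hw a
    have hb := hw b
    have hc := hw c
    simp only [etaTranspose, Real.rpow_sub ht]
    field_simp
  have e4 : t ^ (2 - 2 * p c) * μ c * (∑ b, μ b * etaTranspose p η t a b)
      = t ^ (2 * p a - 2 * p c) * (∑ b, t ^ (2 - 2 * p b) * μ c * μ b * η t b a) := by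
    simp only [Finset.mul_sum]
    refine Finset.sum_congr rfl fun b _ => ?_
    have ha := hw a
    have hb := hw b
    have hc := hw c
    simp only [etaTranspose, Real.rpow_sub ht]
    field_simp
  have e2 : t ^ (2 * p a - 2 * p c) * t ^ (2 - 2 * p a) = t ^ (2 - 2 * p c) := by
    rw [← Real.rpow_add ht]
    ring_nf
  have e6 : p a * (if a = c then 1 else 0) * n
      = t ^ (2 * p a - 2 * p c) * (p c * (if c = a then 1 else 0) * n) := by
    rcases eq_or_ne a c with rfl | h
    · simp
    · simp [h, h.symm]
  rw [kapSource, kapSource, e3, e4, sum_etaTranspose_diag, e6, ← e2]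
  simp only [etaTranspose]
  ring

theorem IsModeEvolution.transpose {η κ : ℝ → Fin D → Fin D → ℝ} {φ ψ ν : ℝ → ℝ} {T : ℝ}
    (h : IsModeEvolution p pphi μ η κ φ ψ ν T) :
    IsModeEvolution p pphi μ (etaTranspose p η) (kapTranspose p η κ) φ ψ ν T := by
  have hr : ∀ t ∈ Set.Ioc 0 T, ∀ q, HasDerivAt (fun s : ℝ => s ^ q) (q * (t ^ q / t)) t := by
    intro t ht q
    rw [← Real.rpow_sub_one ht.1.ne']
    exact Real.hasDerivAt_rpow_const (Or.inl ht.1.ne')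
  refine ⟨fun t ht a c => ?_, fun t ht a c => ?_, h.phi_evol, h.psi_evol, fun t ht => ?_⟩
  · refine ((hr t ht _).mul (h.eta_evol t ht c a)).congr_deriv ?_
    have ht0 := ht.1.ne'
    simp only [etaTranspose, kapTranspose]
    rcases eq_or_ne a c with rfl | hac
    · simp
    · simp only [if_neg hac, if_neg hac.symm]
      field_simp
      ring
  · refine ((hr t ht _).mul ((h.kappa_evol t ht c a).add
      ((h.eta_evol t ht c a).const_mul (2 * (p c - p a))))).congr_deriv ?_
    have ht0 := ht.1.ne'
    rw [kapSource_transpose p μ ht.1]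
    rcases eq_or_ne a c with rfl | hac
    · simp
    · simp only [if_neg hac.symm, Pi.add_apply]
      field_simp
      ring
  · rw [lapseSource_transpose p μ ht.1, h.nu_elliptic t ht]

/-- The action of transposition on the regularized unknowns. -/
def transposeState (p : Fin D → ℝ) (x : ModeState D) : ModeState D :=
  (fun a c => x.1 c a + 2 * (p c - p a) * x.2.1 c a, fun a c => x.2.1 c a, x.2.2)

theorem continuous_transposeState (p : Fin D → ℝ) : Continuous (transposeState p) := by
  unfold transposeState
  fun_prop

theorem stateOf_transpose (p : Fin D → ℝ) (η κ : ℝ → Fin D → Fin D → ℝ) (φ ψ : ℝ → ℝ)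
    {t : ℝ} (ht : 0 < t) :
    stateOf p (etaTranspose p η) (kapTranspose p η κ) φ ψ t
      = transposeState p (stateOf p η κ φ ψ t) := by
  have hm := fun a c : Fin D => mul_weightInt (2 * p a - 2 * p c) ht
  refine Prod.ext ?_ (Prod.ext ?_ rfl)
  · funext a c
    simp only [stateOf, transposeState, kapTranspose]
    linear_combination κ t c a * hm a c
  · funext a c
    have h1 := rpow_mul_weightInt_neg (2 * p a - 2 * p c) ht
    rw [neg_sub] at h1
    simp only [stateOf, transposeState, kapTranspose, etaTranspose]
    linear_combination η t c a * rpow_mul_rpow_swap ht (2 * p c) (2 * p a)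
      + (κ t c a + 2 * (p c - p a) * η t c a) * h1 - η t c a * hm a c

/-- A mode whose limiting data are symmetric is symmetric. -/
theorem IsModeEvolution.symmetric (hb : ModeBounds p pphi μ δ)
    {η κ : ℝ → Fin D → Fin D → ℝ} {φ ψ ν : ℝ → ℝ} (h : IsModeEvolution p pphi μ η κ φ ψ ν 1)
    {x₀ : ModeState D} (hx : Tendsto (stateOf p η κ φ ψ) (𝓝[>] 0) (𝓝 x₀))
    (hsym : transposeState p x₀ = x₀) {t : ℝ} (ht : t ∈ Set.Ioc (0 : ℝ) 1) :
    η t = etaTranspose p η t ∧ κ t = kapTranspose p η κ t := by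
  have hx' : Tendsto (stateOf p (etaTranspose p η) (kapTranspose p η κ) φ ψ) (𝓝[>] 0) (𝓝 x₀) := by
    have := ((continuous_transposeState p).tendsto x₀).comp hx
    rw [hsym] at this
    refine this.congr' ?_
    filter_upwards [self_mem_nhdsWithin] with s hs
    exact (stateOf_transpose p η κ φ ψ hs).symm
  have := h.eq_of_tendsto hb h.transpose hx hx' ht
  exact ⟨this.1, this.2.1⟩

end Symmetry

section Constraints

variable {D : ℕ} {p : Fin D → ℝ} {pphi : ℝ} {μ : Fin D → ℝ} {δ : ℝ}

/-- The Hamiltonian constraint quantity. -/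
noncomputable def hamQ (p : Fin D → ℝ) (pphi : ℝ) (μ : Fin D → ℝ) (t : ℝ)
    (h k : Fin D → Fin D → ℝ) (s : ℝ) : ℝ :=
  lapseSource p μ t h - 2 * (∑ a, p a * k a a) + 4 * pphi * s

/-- The momentum constraint quantity. -/
noncomputable def momQ (p : Fin D → ℝ) (pphi : ℝ) (μ : Fin D → ℝ)
    (h k : Fin D → Fin D → ℝ) (f : ℝ) (i : Fin D) : ℝ :=
  (∑ j, μ j * k i j) + μ i * (-(∑ a, p a * h a a) + 2 * pphi * f) + p i * μ i * (∑ a, h a a)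

theorem sum_kapSource_diag (hp : ∑ i, p i = 1) (t : ℝ) (h : Fin D → Fin D → ℝ) (n : ℝ) :
    ∑ i, kapSource p μ t h n i i = (1 + tauSq p μ t) * n - lapseSource p μ t h := by
  have e1 : ∑ i, t ^ (2 - 2 * p i) * μ i * μ i = tauSq p μ t := by
    simp only [tauSq, pow_two, mul_assoc]
  have e2 : ∑ i, ∑ a, t ^ (2 - 2 * p a) * μ i * μ a * h a i = contraction p μ t h := by
    rw [Finset.sum_comm, contraction]
    exact Finset.sum_congr rfl fun a _ => Finset.sum_congr rfl fun i _ => by ring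
  have e3 : ∑ i, t ^ (2 - 2 * p i) * μ i * ∑ b, μ b * h i b = contraction p μ t h := by
    simp only [contraction, Finset.mul_sum, mul_assoc]
  simp only [kapSource, Finset.sum_add_distrib, Finset.sum_sub_distrib, ← Finset.sum_mul,
    ← Finset.mul_sum, e1, e2, e3, if_true, mul_one, hp, lapseSource]
  ring

theorem sum_mul_kapSource (t : ℝ) (h : Fin D → Fin D → ℝ) (n : ℝ) (i : Fin D) :
    ∑ j, μ j * kapSource p μ t h n i j
      = μ i * (-(tauSq p μ t) * (∑ a, h a a) + contraction p μ t h + tauSq p μ t * n + p i * n) := by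
  have e1 : ∑ j, μ j * (t ^ (2 - 2 * p j) * μ j) = tauSq p μ t :=
    Finset.sum_congr rfl fun j _ => by ring
  have e2 : ∑ j, μ j * ∑ a, t ^ (2 - 2 * p a) * μ i * μ a * h a j
      = μ i * contraction p μ t h := by
    simp only [contraction, Finset.mul_sum]
    rw [Finset.sum_comm]
    exact Finset.sum_congr rfl fun a _ => Finset.sum_congr rfl fun i _ => by ring
  have e3 : ∑ j, μ j * (p i * (if i = j then 1 else 0) * n) = μ i * (p i * n) := by
    simp
  have e : ∀ j, μ j * kapSource p μ t h n i j =
      -(tauSq p μ t) * (μ j * h i j)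
      - (μ j * (t ^ (2 - 2 * p j) * μ j)) * (μ i * (∑ a, h a a))
      + μ j * (∑ a, t ^ (2 - 2 * p a) * μ i * μ a * h a j)
      + (μ j * (t ^ (2 - 2 * p j) * μ j)) * (∑ b, μ b * h i b)
      + (μ j * (t ^ (2 - 2 * p j) * μ j)) * (μ i * n)
      + μ j * (p i * (if i = j then 1 else 0) * n) := fun j => by
    rw [kapSource]
    ring
  simp only [e, Finset.sum_add_distrib, Finset.sum_sub_distrib, ← Finset.sum_mul,
    ← Finset.mul_sum, e1, e3]
  rw [e2]
  ring

theorem sum_p_mul_kapSource (t : ℝ) (h : Fin D → Fin D → ℝ) (n : ℝ) :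
    ∑ i, p i * kapSource p μ t h n i i
      = -(tauSq p μ t) * (∑ i, p i * h i i)
        + (∑ i, p i * (t ^ (2 - 2 * p i) * μ i ^ 2)) * (n - ∑ a, h a a)
        + (∑ a, ∑ i, p i * (t ^ (2 - 2 * p a) * μ a * μ i * h a i))
        + (∑ a, ∑ i, p a * (t ^ (2 - 2 * p a) * μ a * μ i * h a i))
        + (∑ i, p i ^ 2) * n := by
  have e2 : ∑ i, p i * ∑ a, t ^ (2 - 2 * p a) * μ i * μ a * h a i
      = ∑ a, ∑ i, p i * (t ^ (2 - 2 * p a) * μ a * μ i * h a i) := by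
    simp only [Finset.mul_sum]
    rw [Finset.sum_comm]
    exact Finset.sum_congr rfl fun a _ => Finset.sum_congr rfl fun i _ => by ring
  have e3 : ∑ i, p i * (t ^ (2 - 2 * p i) * μ i * ∑ b, μ b * h i b)
      = ∑ a, ∑ i, p a * (t ^ (2 - 2 * p a) * μ a * μ i * h a i) := by
    simp only [Finset.mul_sum]
    exact Finset.sum_congr rfl fun a _ => Finset.sum_congr rfl fun i _ => by ring
  have e : ∀ i, p i * kapSource p μ t h n i i =
      -(tauSq p μ t) * (p i * h i i)
      + (p i * (t ^ (2 - 2 * p i) * μ i ^ 2)) * (n - ∑ a, h a a)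
      + p i * (∑ a, t ^ (2 - 2 * p a) * μ i * μ a * h a i)
      + p i * (t ^ (2 - 2 * p i) * μ i * (∑ b, μ b * h i b))
      + p i ^ 2 * n := fun i => by
    rw [kapSource, if_pos rfl]
    ring
  simp only [e, Finset.sum_add_distrib, ← Finset.sum_mul, ← Finset.mul_sum, e3]
  rw [e2]

theorem hasDerivAt_rpow_div {t : ℝ} (ht : 0 < t) (q : ℝ) :
    HasDerivAt (fun s : ℝ => s ^ q) (q * t ^ q / t) t := by
  rw [mul_div_assoc, ← Real.rpow_sub_one ht.ne']
  exact Real.hasDerivAt_rpow_const (Or.inl ht.ne')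

theorem hasDerivAt_tauSq (p μ : Fin D → ℝ) {t : ℝ} (ht : 0 < t) :
    HasDerivAt (tauSq p μ)
      ((2 * tauSq p μ t - 2 * ∑ i, p i * (t ^ (2 - 2 * p i) * μ i ^ 2)) / t) t := by
  have := HasDerivAt.fun_sum (u := Finset.univ) fun k (_ : k ∈ Finset.univ) =>
    (hasDerivAt_rpow_div ht (2 - 2 * p k)).mul_const (μ k ^ 2)
  refine this.congr_deriv ?_
  rw [tauSq, Finset.mul_sum, Finset.mul_sum, ← Finset.sum_sub_distrib, Finset.sum_div]
  exact Finset.sum_congr rfl fun k _ => by ring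

namespace IsModeEvolution

variable {η κ : ℝ → Fin D → Fin D → ℝ} {φ ψ ν : ℝ → ℝ} {T : ℝ}

theorem hasDerivAt_trace_kappa (h : IsModeEvolution p pphi μ η κ φ ψ ν T) (hp : ∑ i, p i = 1)
    {t : ℝ} (ht : t ∈ Set.Ioc 0 T) : HasDerivAt (fun s => ∑ a, κ s a a) 0 t := by
  refine (HasDerivAt.fun_sum fun a _ => h.kappa_evol t ht a a).congr_deriv ?_
  rw [← Finset.sum_div, sum_kapSource_diag hp, h.nu_elliptic t ht, sub_self, zero_div]

theorem hasDerivAt_trace_eta (h : IsModeEvolution p pphi μ η κ φ ψ ν T) (hp : ∑ i, p i = 1)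
    {t : ℝ} (ht : t ∈ Set.Ioc 0 T) (hκ : ∑ a, κ t a a = 0) :
    HasDerivAt (fun s => ∑ a, η s a a) (-ν t / t) t := by
  refine (HasDerivAt.fun_sum fun a _ => h.eta_evol t ht a a).congr_deriv ?_
  rw [← Finset.sum_div]
  congr 1
  simp only [sub_self, mul_zero, zero_mul, add_zero, if_true, mul_one, Finset.sum_sub_distrib,
    ← Finset.sum_mul, hp, hκ]
  ring

theorem hasDerivAt_sum_p_eta (h : IsModeEvolution p pphi μ η κ φ ψ ν T)
    {t : ℝ} (ht : t ∈ Set.Ioc 0 T) :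
    HasDerivAt (fun s => ∑ a, p a * η s a a)
      (((∑ a, p a * κ t a a) - (∑ a, p a ^ 2) * ν t) / t) t := by
  refine (HasDerivAt.fun_sum fun a _ => (h.eta_evol t ht a a).const_mul (p a)).congr_deriv ?_
  rw [Finset.sum_mul, ← Finset.sum_sub_distrib, Finset.sum_div]
  refine Finset.sum_congr rfl fun a _ => ?_
  rw [if_pos rfl]
  ring

theorem hasDerivAt_contraction (h : IsModeEvolution p pphi μ η κ φ ψ ν T)
    {t : ℝ} (ht : t ∈ Set.Ioc 0 T) :
    HasDerivAt (fun s => contraction p μ s (η s))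
      ((2 * contraction p μ t (η t)
        - 2 * (∑ a, ∑ i, p i * (t ^ (2 - 2 * p a) * μ a * μ i * η t a i))
        + contraction p μ t (κ t)
        - (∑ i, p i * (t ^ (2 - 2 * p i) * μ i ^ 2)) * ν t) / t) t := by
  have := HasDerivAt.fun_sum (u := Finset.univ) fun a (_ : a ∈ Finset.univ) =>
    HasDerivAt.fun_sum (u := Finset.univ) fun i (_ : i ∈ Finset.univ) =>
      (((hasDerivAt_rpow_div ht.1 (2 - 2 * p a)).mul_const (μ a)).mul_const (μ i)).mul
        (h.eta_evol t ht a i)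
  refine this.congr_deriv ?_
  have e : (∑ i, p i * (t ^ (2 - 2 * p i) * μ i ^ 2)) * ν t
      = ∑ a, ∑ i, t ^ (2 - 2 * p a) * μ a * μ i * (p a * (if a = i then 1 else 0) * ν t) := by
    rw [Finset.sum_mul]
    refine Finset.sum_congr rfl fun a _ => ?_
    simp
    ring
  rw [e, contraction, contraction]
  simp only [Finset.mul_sum, Finset.sum_div, ← Finset.sum_sub_distrib, ← Finset.sum_add_distrib]
  refine Finset.sum_congr rfl fun a _ => Finset.sum_congr rfl fun i _ => ?_
  ring

theorem hasDerivAt_momQ (h : IsModeEvolution p pphi μ η κ φ ψ ν T) (hp : ∑ i, p i = 1)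
    (hq : (∑ i, p i ^ 2) + 2 * pphi ^ 2 = 1) {t : ℝ} (ht : t ∈ Set.Ioc 0 T)
    (hκ : ∑ a, κ t a a = 0) (i : Fin D) :
    HasDerivAt (fun s => momQ p pphi μ (η s) (κ s) (φ s) i)
      (μ i / 2 * hamQ p pphi μ t (η t) (κ t) (ψ t) / t) t := by
  have h1 := HasDerivAt.fun_sum (u := Finset.univ) fun j (_ : j ∈ Finset.univ) =>
    (h.kappa_evol t ht i j).const_mul (μ j)
  have h2 := (((h.hasDerivAt_sum_p_eta ht).neg.add
    ((h.phi_evol t ht).const_mul (2 * pphi))).const_mul (μ i))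
  have h3 := (h.hasDerivAt_trace_eta hp ht hκ).const_mul (p i * μ i)
  refine ((h1.add h2).add h3).congr_deriv ?_
  have e : ∑ j, μ j * (kapSource p μ t (η t) (ν t) i j / t)
      = (∑ j, μ j * kapSource p μ t (η t) (ν t) i j) / t := by
    rw [Finset.sum_div]
    exact Finset.sum_congr rfl fun j _ => by ring
  have hν := h.nu_elliptic t ht
  have ht0 := ht.1.ne'
  rw [e, sum_mul_kapSource, hamQ]
  rw [lapseSource] at hν ⊢
  field_simp
  linear_combination 2 * μ i * hν + 2 * μ i * ν t * hq

theorem hasDerivAt_hamQ (h : IsModeEvolution p pphi μ η κ φ ψ ν T) (hp : ∑ i, p i = 1)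
    (hq : (∑ i, p i ^ 2) + 2 * pphi ^ 2 = 1) {t : ℝ} (ht : t ∈ Set.Ioc 0 T)
    (hκ : ∑ a, κ t a a = 0) (hη : η t = etaTranspose p η t) :
    HasDerivAt (fun s => hamQ p pphi μ s (η s) (κ s) (ψ s))
      (-2 * (∑ i, t ^ (2 - 2 * p i) * μ i * momQ p pphi μ (η t) (κ t) (φ t) i) / t) t := by
  have h1 := ((hasDerivAt_tauSq p μ ht.1).const_mul 2).mul (h.hasDerivAt_trace_eta hp ht hκ)
  have h2 := (h.hasDerivAt_contraction ht).const_mul 2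
  have h3 := (HasDerivAt.fun_sum (u := Finset.univ) fun a (_ : a ∈ Finset.univ) =>
    (h.kappa_evol t ht a a).const_mul (p a)).const_mul 2
  have h4 := (h.psi_evol t ht).const_mul (4 * pphi)
  refine (((h1.sub h2).sub h3).add h4).congr_deriv ?_
  have e3 : ∑ j, p j * (kapSource p μ t (η t) (ν t) j j / t)
      = (∑ j, p j * kapSource p μ t (η t) (ν t) j j) / t := by
    rw [Finset.sum_div]
    exact Finset.sum_congr rfl fun j _ => by ring
  have eM : ∑ i, t ^ (2 - 2 * p i) * μ i * momQ p pphi μ (η t) (κ t) (φ t) i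
      = contraction p μ t (κ t)
        + tauSq p μ t * (-(∑ a, p a * η t a a) + 2 * pphi * φ t)
        + (∑ i, p i * (t ^ (2 - 2 * p i) * μ i ^ 2)) * ∑ a, η t a a := by
    rw [contraction, tauSq, Finset.sum_mul, Finset.sum_mul, ← Finset.sum_add_distrib,
      ← Finset.sum_add_distrib]
    refine Finset.sum_congr rfl fun i _ => ?_
    have : ∑ j, t ^ (2 - 2 * p i) * μ i * μ j * κ t i j
        = t ^ (2 - 2 * p i) * μ i * ∑ j, μ j * κ t i j := by
      simp only [Finset.mul_sum, mul_assoc]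
    rw [this, momQ]
    ring
  have eS : ∑ a, ∑ i, p i * (t ^ (2 - 2 * p a) * μ a * μ i * η t a i)
      = ∑ a, ∑ i, p a * (t ^ (2 - 2 * p a) * μ a * μ i * η t a i) := by
    rw [Finset.sum_comm]
    refine Finset.sum_congr rfl fun a _ => Finset.sum_congr rfl fun i _ => ?_
    have hia : η t i a = t ^ (2 * p i - 2 * p a) * η t a i := congrFun (congrFun hη i) a
    have ha := (Real.rpow_pos_of_pos ht.1 (2 * p a)).ne'
    have hi := (Real.rpow_pos_of_pos ht.1 (2 * p i)).ne'
    rw [hia]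
    simp only [Real.rpow_sub ht.1]
    field_simp
  have hν := h.nu_elliptic t ht
  have ht0 := ht.1.ne'
  rw [e3, eM, sum_p_mul_kapSource, eS]
  rw [lapseSource] at hν
  field_simp
  linear_combination (-2) * hν - 2 * ν t * hq

end IsModeEvolution

end Constraints

section Propagation

variable {D : ℕ} {p : Fin D → ℝ} {pphi : ℝ} {μ : Fin D → ℝ} {δ : ℝ}

theorem ModeBounds.tendsto_log_mul_lapseSource (hb : ModeBounds p pphi μ δ) {X : ℝ → ModeState D}
    {x₀ : ModeState D} (hX : Tendsto X (𝓝[>] 0) (𝓝 x₀)) :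
    Tendsto (fun t => (1 - Real.log t) * lapseSource p μ t (etaOf p t (X t)))
      (𝓝[>] 0) (𝓝 0) := by
  have hδ := hb.delta_pos
  have h1 : Tendsto (fun t : ℝ => 8 * (D : ℝ) ^ 2 * ((1 + 2 / δ) ^ 2 * t ^ δ) * ‖X t‖)
      (𝓝[>] 0) (𝓝 (8 * (D : ℝ) ^ 2 * ((1 + 2 / δ) ^ 2 * 0 ^ δ) * ‖x₀‖)) := by
    refine Tendsto.mul (Tendsto.const_mul _ (Tendsto.const_mul _ ?_)) hX.norm
    exact ((Real.continuousAt_rpow_const 0 δ (Or.inr hδ.le)).tendsto).mono_left nhdsWithin_le_nhds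
  rw [Real.zero_rpow hδ.ne', mul_zero, mul_zero, zero_mul] at h1
  refine squeeze_zero_norm' ?_ h1
  filter_upwards [Ioc_mem_nhdsGT one_pos] with t ht
  have hL := one_le_one_sub_log ht
  have h2 := ModeBounds.one_sub_log_le hδ ht
  rw [Real.norm_eq_abs, abs_mul, abs_of_pos (by linarith)]
  calc _ ≤ (1 - Real.log t) * (8 * D ^ 2 * (t ^ (2 * δ) * ((1 - Real.log t) * ‖X t‖))) := by
        have := hb.abs_lapseSource_le ht (X t)
        gcongr
    _ = 8 * D ^ 2 * (t ^ (2 * δ) * (1 - Real.log t) ^ 2) * ‖X t‖ := by ring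
    _ ≤ _ := by gcongr

theorem ModeBounds.tendsto_lapseSource (hb : ModeBounds p pphi μ δ) {X : ℝ → ModeState D}
    {x₀ : ModeState D} (hX : Tendsto X (𝓝[>] 0) (𝓝 x₀)) :
    Tendsto (fun t => lapseSource p μ t (etaOf p t (X t))) (𝓝[>] 0) (𝓝 0) := by
  have h1 := (hb.tendsto_log_mul_lapseSource hX).norm
  rw [norm_zero] at h1
  refine squeeze_zero_norm' ?_ h1
  filter_upwards [Ioc_mem_nhdsGT one_pos] with t ht
  have hL := one_le_one_sub_log ht
  rw [norm_mul, Real.norm_of_nonneg (show 0 ≤ 1 - Real.log t by linarith)]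
  exact le_mul_of_one_le_left (norm_nonneg _) hL

theorem etaOf_diag (p : Fin D → ℝ) {t : ℝ} (ht : 0 < t) (x : ModeState D) (a : Fin D) :
    etaOf p t x a a = x.2.1 a a + Real.log t * x.1 a a := by
  simp [etaOf, weightInt_zero ht]

/-- The asymptotic constraints on the limits of the regularized unknowns. -/
structure AsymptoticConstraints (p : Fin D → ℝ) (pphi : ℝ) (μ : Fin D → ℝ)
    (x : ModeState D) : Prop where
  trace : ∑ a, x.1 a a = 0
  hamiltonian : -(∑ a, p a * x.1 a a) + 2 * pphi * x.2.2.1 = 0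
  momentum : ∀ i, (∑ j, μ j * x.1 i j)
    + μ i * (-(∑ a, p a * x.2.1 a a) + 2 * pphi * x.2.2.2) + p i * μ i * (∑ a, x.2.1 a a) = 0
  symmetric : transposeState p x = x

namespace IsModeEvolution

variable {η κ : ℝ → Fin D → Fin D → ℝ} {φ ψ ν : ℝ → ℝ}

theorem trace_kappa_eq_zero (h : IsModeEvolution p pphi μ η κ φ ψ ν 1) (hp : ∑ i, p i = 1)
    {x₀ : ModeState D} (hx : Tendsto (stateOf p η κ φ ψ) (𝓝[>] 0) (𝓝 x₀))
    (hx₀ : AsymptoticConstraints p pphi μ x₀) {t : ℝ} (ht : t ∈ Set.Ioc (0 : ℝ) 1) :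
    ∑ a, κ t a a = 0 := by
  have hlim : Tendsto (fun s => ∑ a, κ s a a) (𝓝[>] 0) (𝓝 0) := by
    have h1 : Continuous fun x : ModeState D => ∑ a, x.1 a a := by fun_prop
    have := (h1.tendsto x₀).comp hx
    rwa [hx₀.trace] at this
  have h2 := norm_le_of_singular (v := fun _ => (0 : ℝ)) one_pos one_pos
    (fun s hs => by simpa using h.hasDerivAt_trace_kappa hp hs)
    (fun s hs => by
      have := Real.rpow_pos_of_pos hs.1 1
      rw [norm_zero]
      positivity) hlim t ht
  rw [norm_zero, mul_zero] at h2
  exact norm_le_zero_iff.1 h2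

theorem constraints_eq_zero (hb : ModeBounds p pphi μ δ)
    (h : IsModeEvolution p pphi μ η κ φ ψ ν 1) (hp : ∑ i, p i = 1)
    (hq : (∑ i, p i ^ 2) + 2 * pphi ^ 2 = 1)
    {x₀ : ModeState D} (hx : Tendsto (stateOf p η κ φ ψ) (𝓝[>] 0) (𝓝 x₀))
    (hx₀ : AsymptoticConstraints p pphi μ x₀) {t : ℝ} (ht : t ∈ Set.Ioc (0 : ℝ) 1) :
    hamQ p pphi μ t (η t) (κ t) (ψ t) = 0 ∧ ∀ i, momQ p pphi μ (η t) (κ t) (φ t) i = 0 := by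
  have hδ := hb.delta_pos
  have htr := fun {s : ℝ} (hs : s ∈ Set.Ioc (0 : ℝ) 1) => h.trace_kappa_eq_zero hp hx hx₀ hs
  have hη := fun {s : ℝ} (hs : s ∈ Set.Ioc (0 : ℝ) 1) => (h.symmetric hb hx hx₀.symmetric hs).1
  have hηs := fun {s : ℝ} (hs : 0 < s) => etaOf_stateOf p η κ φ ψ hs
  set H : ℝ → ℝ := fun s => hamQ p pphi μ s (η s) (κ s) (ψ s) with hH
  set M : Fin D → ℝ → ℝ := fun i s => momQ p pphi μ (η s) (κ s) (φ s) i with hM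
  set vH : ℝ → ℝ := fun s => -2 * (∑ i, s ^ (2 - 2 * p i) * μ i * M i s) with hvH
  -- the regularized constraint quantities
  set Y : ℝ → (Fin D → ℝ) × ℝ :=
    fun s => (fun i => M i s - μ i / 2 * (Real.log s * H s), H s) with hY
  set v : ℝ → (Fin D → ℝ) × ℝ :=
    fun s => (fun i => -(μ i / 2 * (Real.log s * vH s)), vH s) with hv
  have hdH : ∀ s ∈ Set.Ioc (0 : ℝ) 1, HasDerivAt H (vH s / s) s := fun s hs =>
    h.hasDerivAt_hamQ hp hq hs (htr hs) (hη hs)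
  have hdY : ∀ s ∈ Set.Ioc (0 : ℝ) 1, HasDerivAt Y (s⁻¹ • v s) s := by
    intro s hs
    have hs0 := hs.1.ne'
    refine HasDerivAt.prodMk (hasDerivAt_pi.2 fun i => ?_) ?_
    · refine ((h.hasDerivAt_momQ hp hq hs (htr hs) i).sub
        (((Real.hasDerivAt_log hs0).mul (hdH s hs)).const_mul (μ i / 2))).congr_deriv ?_
      simp only [hv, Pi.smul_apply, smul_eq_mul]
      field_simp
      ring
    · refine (hdH s hs).congr_deriv ?_
      simp only [hv, smul_eq_mul]
      field_simp
  have hvle : ∀ s ∈ Set.Ioc (0 : ℝ) 1,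
      ‖v s‖ ≤ (2 * D * (1 + 2 / δ) ^ 2 + 1) * s ^ δ * ‖Y s‖ := by
    intro s hs
    have hL := one_le_one_sub_log hs
    have hl := Real.log_nonpos hs.1.le hs.2
    have hP := Real.rpow_pos_of_pos hs.1 (2 * δ)
    have hPδ := Real.rpow_pos_of_pos hs.1 δ
    have hN := norm_nonneg (Y s)
    have hHle : |H s| ≤ ‖Y s‖ := norm_snd_le (Y s)
    have hMle : ∀ i, |M i s| ≤ (1 - Real.log s) * ‖Y s‖ := by
      intro i
      have h1 : |(Y s).1 i| ≤ ‖Y s‖ := (norm_le_pi_norm _ i).trans (norm_fst_le (Y s))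
      have h2 : M i s = (Y s).1 i + μ i / 2 * (Real.log s * H s) := by simp [hY]
      have h3 : |μ i / 2 * (Real.log s * H s)| ≤ 1 * (-Real.log s * ‖Y s‖) := by
        rw [abs_mul, abs_mul, abs_of_nonpos hl]
        have h4 : |μ i / 2| ≤ 1 := by
          rw [abs_div, abs_two]
          linarith [hb.abs_mu_le i]
        have : 0 ≤ -Real.log s := by linarith
        gcongr
      rw [h2]
      refine (abs_add_le _ _).trans ?_
      linarith
    have hvHle : |vH s| ≤ 2 * D * (s ^ (2 * δ) * ((1 - Real.log s) * ‖Y s‖)) := by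
      have h1 : |∑ i, s ^ (2 - 2 * p i) * μ i * M i s|
          ≤ D * (s ^ (2 * δ) * ((1 - Real.log s) * ‖Y s‖)) := by
        refine abs_sum_le_card_mul fun i => ?_
        have h2 := hb.rpow_two_sub_le hs i
        have h3 := Real.rpow_pos_of_pos hs.1 (2 - 2 * p i)
        have h4 := hb.abs_mu_le i
        rw [abs_mul, abs_mul, abs_of_pos h3]
        calc _ ≤ s ^ (2 * δ) * 1 * ((1 - Real.log s) * ‖Y s‖) :=
              mul_le_mul (mul_le_mul h2 h4 (abs_nonneg _) hP.le) (hMle i) (abs_nonneg _)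
                (by positivity)
          _ = _ := by ring
      rw [hvH]
      simp only [abs_mul, abs_neg, abs_two]
      linarith
    have hLv : (1 - Real.log s) * |vH s| ≤ (2 * D * (1 + 2 / δ) ^ 2 + 1) * s ^ δ * ‖Y s‖ := by
      have h1 := ModeBounds.one_sub_log_le hδ hs
      calc _ ≤ (1 - Real.log s) * (2 * D * (s ^ (2 * δ) * ((1 - Real.log s) * ‖Y s‖))) := by gcongr
        _ = 2 * D * (s ^ (2 * δ) * (1 - Real.log s) ^ 2) * ‖Y s‖ := by ring
        _ ≤ 2 * D * ((1 + 2 / δ) ^ 2 * s ^ δ) * ‖Y s‖ := by gcongr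
        _ ≤ _ := by nlinarith [mul_nonneg hPδ.le hN]
    refine le_trans ?_ hLv
    have hLv0 : 0 ≤ (1 - Real.log s) * |vH s| := mul_nonneg (by linarith) (abs_nonneg _)
    refine norm_prod_le_iff.2 ⟨(pi_norm_le_iff_of_nonneg hLv0).2 fun i => ?_, ?_⟩
    · have h4 : |μ i / 2| ≤ 1 := by
        rw [abs_div, abs_two]
        linarith [hb.abs_mu_le i]
      change |-(μ i / 2 * (Real.log s * vH s))| ≤ _
      rw [abs_neg, abs_mul, abs_mul, abs_of_nonpos hl]
      have h5 : 0 ≤ -Real.log s * |vH s| := mul_nonneg (by linarith) (abs_nonneg _)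
      nlinarith [abs_nonneg (vH s)]
    · exact le_mul_of_one_le_left (abs_nonneg _) hL
  have hLog := hb.tendsto_log_mul_lapseSource hx
  have hLap := hb.tendsto_lapseSource hx
  have hlimH : Tendsto H (𝓝[>] 0) (𝓝 0) := by
    have h1 : Continuous fun x : ModeState D => -2 * (∑ a, p a * x.1 a a) + 4 * pphi * x.2.2.1 := by
      fun_prop
    have h2 := hLap.add ((h1.tendsto x₀).comp hx)
    rw [show (0 : ℝ) + (-2 * (∑ a, p a * x₀.1 a a) + 4 * pphi * x₀.2.2.1) = 0 by
      linear_combination 2 * hx₀.hamiltonian] at h2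
    refine h2.congr' ?_
    filter_upwards [self_mem_nhdsWithin] with s hs
    have e := hηs hs
    simp only [Function.comp, hH, hamQ, e]
    simp only [stateOf]
    ring
  have hlimM : ∀ i, Tendsto (fun s => M i s - μ i / 2 * (Real.log s * H s)) (𝓝[>] 0) (𝓝 0) := by
    intro i
    have h1 : Continuous fun x : ModeState D => (∑ j, μ j * x.1 i j)
        + μ i * (-(∑ a, p a * x.2.1 a a) + 2 * pphi * x.2.2.2) + p i * μ i * (∑ a, x.2.1 a a) := by
      fun_prop
    have h2 := ((h1.tendsto x₀).comp hx).add ((hLog.sub hLap).const_mul (μ i / 2))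
    rw [hx₀.momentum i, sub_zero, mul_zero, add_zero] at h2
    refine h2.congr' ?_
    filter_upwards [Ioc_mem_nhdsGT one_pos] with s hs
    have hdiag : ∀ a, η s a a = (stateOf p η κ φ ψ s).2.1 a a + Real.log s * κ s a a := by
      intro a
      have := etaOf_diag p hs.1 (stateOf p η κ φ ψ s) a
      rwa [hηs hs.1] at this
    have hφ : φ s = (stateOf p η κ φ ψ s).2.2.2 + Real.log s * ψ s :=
      (phiOf_stateOf p η κ φ ψ s).symm
    have hκ1 : (stateOf p η κ φ ψ s).1 = κ s := rfl
    have e1 : ∑ a, η s a a = ∑ a, (stateOf p η κ φ ψ s).2.1 a a := by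
      simp only [hdiag, Finset.sum_add_distrib, ← Finset.mul_sum, htr hs, mul_zero, add_zero]
    have e2 : ∑ a, p a * η s a a = (∑ a, p a * (stateOf p η κ φ ψ s).2.1 a a)
        + Real.log s * ∑ a, p a * κ s a a := by
      rw [Finset.mul_sum, ← Finset.sum_add_distrib]
      exact Finset.sum_congr rfl fun a _ => by rw [hdiag a]; ring
    simp only [Function.comp, hηs hs.1, hH, hM, hamQ, momQ]
    rw [e1, e2, hκ1]
    linear_combination (-2 * pphi * μ i) * hφ
  have hlimY : Tendsto Y (𝓝[>] 0) (𝓝 0) :=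
    (tendsto_pi_nhds.2 hlimM).prodMk_nhds hlimH
  have hfin := norm_le_of_singular hδ (by positivity) hdY hvle hlimY t ht
  rw [norm_zero, mul_zero] at hfin
  have hY0 := norm_le_zero_iff.1 hfin
  have hH0 : H t = 0 := congrArg Prod.snd hY0
  refine ⟨hH0, fun i => ?_⟩
  have h1 := congrFun (congrArg Prod.fst hY0) i
  simp only [hY, hH0, mul_zero, sub_zero] at h1
  exact h1

end IsModeEvolution

end Propagation

section Rescaling

variable {D : ℕ}

/-- The rescaling of a mixed tensor induced by `t ↦ c t`. -/
noncomputable def rescaleMat (p : Fin D → ℝ) (c : ℝ) (h : Fin D → Fin D → ℝ) (i j : Fin D) : ℝ :=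
  c ^ (p j - p i) * h i j

/-- The rescaling of the wave vector induced by `t ↦ c t`. -/
noncomputable def rescaleVec (p : Fin D → ℝ) (c : ℝ) (l : Fin D → ℝ) (k : Fin D) : ℝ :=
  c ^ (1 - p k) * l k

theorem rpow_sub_eq_div (p : Fin D → ℝ) {c : ℝ} (hc : 0 < c) (i j : Fin D) :
    c ^ (p j - p i) = c ^ (1 - p i) / c ^ (1 - p j) := by
  rw [← Real.rpow_sub hc]
  ring_nf

theorem mul_rpow_two_sub (p : Fin D → ℝ) {c s : ℝ} (hc : 0 < c) (hs : 0 < s) (k : Fin D) :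
    (c * s) ^ (2 - 2 * p k) = (c ^ (1 - p k)) ^ 2 * s ^ (2 - 2 * p k) := by
  rw [Real.mul_rpow hc.le hs.le, pow_two, ← Real.rpow_add hc]
  ring_nf

theorem rescaleMat_diag (p : Fin D → ℝ) (c : ℝ) (h : Fin D → Fin D → ℝ) (a : Fin D) :
    rescaleMat p c h a a = h a a := by
  simp [rescaleMat]

theorem rescaleMat_inv (p : Fin D → ℝ) {c : ℝ} (hc : 0 < c) (h : Fin D → Fin D → ℝ) :
    rescaleMat p c (rescaleMat p c⁻¹ h) = h := by
  funext i j
  have := (Real.rpow_pos_of_pos hc (p j - p i)).ne'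
  simp only [rescaleMat, Real.inv_rpow hc.le]
  field_simp

theorem rescaleVec_inv (p : Fin D → ℝ) {c : ℝ} (hc : 0 < c) (l : Fin D → ℝ) :
    rescaleVec p c⁻¹ (rescaleVec p c l) = l := by
  funext k
  have := (Real.rpow_pos_of_pos hc (1 - p k)).ne'
  simp only [rescaleVec, Real.inv_rpow hc.le]
  field_simp

theorem tauSq_rescaleVec (p : Fin D → ℝ) {c s : ℝ} (hc : 0 < c) (hs : 0 < s) (l : Fin D → ℝ) :
    tauSq p (rescaleVec p c l) s = tauSq p l (c * s) := by
  refine Finset.sum_congr rfl fun k _ => ?_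
  rw [mul_rpow_two_sub p hc hs, rescaleVec]
  ring

theorem contraction_rescale (p : Fin D → ℝ) {c s : ℝ} (hc : 0 < c) (hs : 0 < s) (l : Fin D → ℝ)
    (h : Fin D → Fin D → ℝ) :
    contraction p (rescaleVec p c l) s (rescaleMat p c h) = contraction p l (c * s) h := by
  refine Finset.sum_congr rfl fun a _ => Finset.sum_congr rfl fun i _ => ?_
  have hi := (Real.rpow_pos_of_pos hc (1 - p i)).ne'
  simp only [mul_rpow_two_sub p hc hs, rescaleVec, rescaleMat, rpow_sub_eq_div p hc]
  field_simp

theorem lapseSource_rescale (p : Fin D → ℝ) {c s : ℝ} (hc : 0 < c) (hs : 0 < s) (l : Fin D → ℝ)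
    (h : Fin D → Fin D → ℝ) :
    lapseSource p (rescaleVec p c l) s (rescaleMat p c h) = lapseSource p l (c * s) h := by
  simp only [lapseSource, tauSq_rescaleVec p hc hs, contraction_rescale p hc hs, rescaleMat_diag]

theorem kapSource_rescale (p : Fin D → ℝ) {c s : ℝ} (hc : 0 < c) (hs : 0 < s) (l : Fin D → ℝ)
    (h : Fin D → Fin D → ℝ) (n : ℝ) (i j : Fin D) :
    kapSource p (rescaleVec p c l) s (rescaleMat p c h) n i j
      = c ^ (p j - p i) * kapSource p l (c * s) h n i j := by
  have hv := fun k => (Real.rpow_pos_of_pos hc (1 - p k)).ne'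
  have hi := hv i
  have e3 : (∑ a, s ^ (2 - 2 * p a) * rescaleVec p c l i * rescaleVec p c l a
        * rescaleMat p c h a j)
      = c ^ (p j - p i) * (∑ a, (c * s) ^ (2 - 2 * p a) * l i * l a * h a j) := by
    rw [Finset.mul_sum]
    refine Finset.sum_congr rfl fun a _ => ?_
    have ha := hv a
    simp only [mul_rpow_two_sub p hc hs, rescaleVec, rescaleMat, rpow_sub_eq_div p hc]
    field_simp
  have e4 : (∑ b, rescaleVec p c l b * rescaleMat p c h i b)
      = c ^ (1 - p i) * (∑ b, l b * h i b) := by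
    rw [Finset.mul_sum]
    refine Finset.sum_congr rfl fun b _ => ?_
    have hb := hv b
    simp only [rescaleVec, rescaleMat, rpow_sub_eq_div p hc]
    field_simp
  have e6 : p i * (if i = j then 1 else 0) * n
      = c ^ (p j - p i) * (p i * (if i = j then 1 else 0) * n) := by
    rcases eq_or_ne i j with rfl | hij
    · simp
    · simp [hij]
  have eA : c ^ (1 - p i) = c ^ (p j - p i) * c ^ (1 - p j) := by
    rw [← Real.rpow_add hc]
    ring_nf
  rw [kapSource, kapSource, e3, e4, tauSq_rescaleVec p hc hs, mul_rpow_two_sub p hc hs j]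
  simp only [rescaleMat_diag]
  simp only [rescaleMat, rescaleVec, eA]
  linear_combination e6

/-- Rescaling time by a constant maps modes to modes. -/
theorem IsModeEvolution.rescale {p : Fin D → ℝ} {pphi : ℝ} {l : Fin D → ℝ}
    {η κ : ℝ → Fin D → Fin D → ℝ} {φ ψ ν : ℝ → ℝ} {T : ℝ}
    (h : IsModeEvolution p pphi l η κ φ ψ ν T) {c S : ℝ} (hc : 0 < c) (hS : c * S = T) :
    IsModeEvolution p pphi (rescaleVec p c l) (fun s => rescaleMat p c (η (c * s)))
      (fun s => rescaleMat p c (κ (c * s))) (fun s => φ (c * s)) (fun s => ψ (c * s))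
      (fun s => ν (c * s)) S := by
  have hmem : ∀ s ∈ Set.Ioc 0 S, c * s ∈ Set.Ioc 0 T := fun s hs =>
    ⟨mul_pos hc hs.1, hS ▸ mul_le_mul_of_nonneg_left hs.2 hc.le⟩
  have hcomp : ∀ {f : ℝ → ℝ} {f' s : ℝ}, s ∈ Set.Ioc 0 S → HasDerivAt f (f' / (c * s)) (c * s) →
      HasDerivAt (fun s => f (c * s)) (f' / s) s := by
    intro f f' s hs hf
    have hs0 := hs.1.ne'
    have := hf.comp s ((hasDerivAt_id s).const_mul c)
    refine this.congr_deriv ?_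
    field_simp
  refine ⟨fun s hs i j => ?_, fun s hs i j => ?_, fun s hs => hcomp hs (h.phi_evol _ (hmem s hs)),
    fun s hs => ?_, fun s hs => ?_⟩
  · refine ((hcomp hs (h.eta_evol _ (hmem s hs) i j)).const_mul (c ^ (p j - p i))).congr_deriv ?_
    simp only [rescaleMat]
    rcases eq_or_ne i j with rfl | hij
    · simp
    · simp only [if_neg hij]
      ring
  · refine ((hcomp hs (h.kappa_evol _ (hmem s hs) i j)).const_mul (c ^ (p j - p i))).congr_deriv ?_
    rw [kapSource_rescale p hc hs.1, mul_div_assoc]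
  · rw [tauSq_rescaleVec p hc hs.1]
    exact hcomp hs (h.psi_evol _ (hmem s hs))
  · rw [tauSq_rescaleVec p hc hs.1, lapseSource_rescale p hc hs.1]
    exact h.nu_elliptic _ (hmem s hs)

theorem hamQ_rescale (p : Fin D → ℝ) (pphi : ℝ) {c s : ℝ} (hc : 0 < c) (hs : 0 < s)
    (l : Fin D → ℝ) (h k : Fin D → Fin D → ℝ) (r : ℝ) :
    hamQ p pphi (rescaleVec p c l) s (rescaleMat p c h) (rescaleMat p c k) r
      = hamQ p pphi l (c * s) h k r := by
  simp only [hamQ, lapseSource_rescale p hc hs, rescaleMat_diag]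

theorem momQ_rescale (p : Fin D → ℝ) (pphi : ℝ) {c : ℝ} (hc : 0 < c)
    (l : Fin D → ℝ) (h k : Fin D → Fin D → ℝ) (f : ℝ) (i : Fin D) :
    momQ p pphi (rescaleVec p c l) (rescaleMat p c h) (rescaleMat p c k) f i
      = c ^ (1 - p i) * momQ p pphi l h k f i := by
  have e : (∑ b, rescaleVec p c l b * rescaleMat p c k i b)
      = c ^ (1 - p i) * (∑ b, l b * k i b) := by
    rw [Finset.mul_sum]
    refine Finset.sum_congr rfl fun b _ => ?_
    have hb := (Real.rpow_pos_of_pos hc (1 - p b)).ne'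
    simp only [rescaleVec, rescaleMat, rpow_sub_eq_div p hc]
    field_simp
  simp only [momQ, e, rescaleMat_diag]
  simp only [rescaleVec]
  ring

theorem rpow_mul_transpose_rescale (p : Fin D → ℝ) {c s : ℝ} (hc : 0 < c) (hs : 0 < s)
    (x : ℝ) (a b : Fin D) :
    s ^ (2 * p a - 2 * p b) * (c ^ (p a - p b) * x)
      = c ^ (p b - p a) * ((c * s) ^ (2 * p a - 2 * p b) * x) := by
  rw [Real.mul_rpow hc.le hs.le]
  have : c ^ (p a - p b) = c ^ (p b - p a) * c ^ (2 * p a - 2 * p b) := by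
    rw [← Real.rpow_add hc]
    ring_nf
  rw [this]
  ring

theorem etaTranspose_rescale (p : Fin D → ℝ) {c s : ℝ} (hc : 0 < c) (hs : 0 < s)
    (η : ℝ → Fin D → Fin D → ℝ) :
    etaTranspose p (fun s => rescaleMat p c (η (c * s))) s
      = rescaleMat p c (etaTranspose p η (c * s)) := by
  funext a b
  exact rpow_mul_transpose_rescale p hc hs _ a b

theorem kapTranspose_rescale (p : Fin D → ℝ) {c s : ℝ} (hc : 0 < c) (hs : 0 < s)
    (η κ : ℝ → Fin D → Fin D → ℝ) :
    kapTranspose p (fun s => rescaleMat p c (η (c * s))) (fun s => rescaleMat p c (κ (c * s))) s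
      = rescaleMat p c (kapTranspose p η κ (c * s)) := by
  funext a b
  have := rpow_mul_transpose_rescale p hc hs
    (κ (c * s) b a + 2 * (p b - p a) * η (c * s) b a) a b
  simp only [kapTranspose, rescaleMat]
  rw [← this]
  ring

theorem IsModeEvolution.continuousOn_nu {p : Fin D → ℝ} {pphi : ℝ} {l : Fin D → ℝ}
    {η κ : ℝ → Fin D → Fin D → ℝ} {φ ψ ν : ℝ → ℝ} {T : ℝ}
    (h : IsModeEvolution p pphi l η κ φ ψ ν T) : ContinuousOn ν (Set.Ioc 0 T) := by
  have hη : ∀ i j, ContinuousOn (fun s => η s i j) (Set.Ioc 0 T) := fun i j s hs =>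
    (h.eta_evol s hs i j).continuousAt.continuousWithinAt
  have hτ : ContinuousOn (tauSq p l) (Set.Ioc 0 T) := fun s hs =>
    (hasDerivAt_tauSq p l hs.1).continuousAt.continuousWithinAt
  have hr : ∀ q : ℝ, ContinuousOn (fun s : ℝ => s ^ q) (Set.Ioc 0 T) := fun q s hs =>
    (Real.continuousAt_rpow_const s q (Or.inl hs.1.ne')).continuousWithinAt
  have hc : ContinuousOn (fun s => lapse p l s (η s)) (Set.Ioc 0 T) := by
    refine ContinuousOn.div ?_ (continuousOn_const.add hτ)
      fun s hs => (one_add_tauSq_pos p l hs.1).ne'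
    unfold lapseSource contraction
    fun_prop
  refine hc.congr fun s hs => ?_
  have h1 := one_add_tauSq_pos p l hs.1
  simp only [lapse]
  rw [← h.nu_elliptic s hs]
  field_simp

end Rescaling

section CMCTC

variable {D : ℕ} {p : Fin D → ℝ} {pphi : ℝ} {lam : Fin D → ℤ}
  {η κ : ℝ → Fin D → Fin D → ℝ} {φ ψ ν : ℝ → ℝ} {T : ℝ}

theorem tau_sq (p : Fin D → ℝ) (lam : Fin D → ℤ) {t : ℝ} (ht : 0 < t) :
    tau p lam t ^ 2 = tauSq p (fun k => (lam k : ℝ)) t :=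
  Real.sq_sqrt (tauSq_nonneg p (fun k => (lam k : ℝ)) ht)

theorem IsCMCTCSolution.isModeEvolution
    (h : IsCMCTCSolution p pphi lam η κ φ ψ ν (Set.Ioc 0 T)) :
    IsModeEvolution p pphi (fun k => (lam k : ℝ)) η κ φ ψ ν T := by
  refine ⟨h.eta_evol, fun t ht i j => ?_, h.phi_evol, fun t ht => ?_, fun t ht => ?_⟩
  · refine (h.kappa_evol t ht i j).congr_deriv ?_
    rw [tau_sq p lam ht.1, kapSource]
  · rw [← tau_sq p lam ht.1]
    exact h.psi_evol t ht
  · rw [lapseSource, contraction, ← tau_sq p lam ht.1]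
    exact h.nu_elliptic t ht

theorem IsCMCTCSolution.eta_eq_transpose
    (h : IsCMCTCSolution p pphi lam η κ φ ψ ν (Set.Ioc 0 T)) {t : ℝ} (ht : t ∈ Set.Ioc 0 T) :
    η t = etaTranspose p η t := by
  funext a c
  have h1 := h.sym_eta t ht a c
  have h2 : t ^ (2 * p a) * t ^ (-(2 * p a)) = 1 := by
    rw [← Real.rpow_add ht.1]
    simp
  rw [etaTranspose, sub_eq_add_neg, Real.rpow_add ht.1, mul_assoc, ← h1, ← mul_assoc, h2, one_mul]

theorem IsModeEvolution.isCMCTCSolution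
    (h : IsModeEvolution p pphi (fun k => (lam k : ℝ)) η κ φ ψ ν T)
    (htr : ∀ t ∈ Set.Ioc 0 T, ∑ a, κ t a a = 0)
    (hham : ∀ t ∈ Set.Ioc 0 T, hamQ p pphi (fun k => (lam k : ℝ)) t (η t) (κ t) (ψ t) = 0)
    (hmom : ∀ t ∈ Set.Ioc 0 T, ∀ i, momQ p pphi (fun k => (lam k : ℝ)) (η t) (κ t) (φ t) i = 0)
    (hη : ∀ t ∈ Set.Ioc 0 T, η t = etaTranspose p η t)
    (hκ : ∀ t ∈ Set.Ioc 0 T, κ t = kapTranspose p η κ t) :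
    IsCMCTCSolution p pphi lam η κ φ ψ ν (Set.Ioc 0 T) := by
  have hr : ∀ {t : ℝ}, 0 < t → ∀ a c, t ^ (-(2 * p a)) * t ^ (2 * p a - 2 * p c)
      = t ^ (-(2 * p c)) := by
    intro t ht a c
    rw [← Real.rpow_add ht]
    ring_nf
  refine ⟨h.continuousOn_nu, h.eta_evol, fun t ht i j => ?_, h.phi_evol, fun t ht => ?_,
    fun t ht => ?_, htr, fun t ht => ?_, hmom, fun t ht a c => ?_, fun t ht a c => ?_⟩
  · refine (h.kappa_evol t ht i j).congr_deriv ?_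
    rw [tau_sq p lam ht.1, kapSource]
  · rw [tau_sq p lam ht.1]
    exact h.psi_evol t ht
  · rw [tau_sq p lam ht.1]
    exact h.nu_elliptic t ht
  · rw [tau_sq p lam ht.1]
    exact hham t ht
  · have h1 : η t a c = t ^ (2 * p a - 2 * p c) * η t c a := congrFun (congrFun (hη t ht) a) c
    linear_combination t ^ (-(2 * p a)) * h1 + η t c a * hr ht.1 a c
  · have h1 : η t a c = t ^ (2 * p a - 2 * p c) * η t c a := congrFun (congrFun (hη t ht) a) c
    have h2 : κ t a c = t ^ (2 * p a - 2 * p c) * (κ t c a + 2 * (p c - p a) * η t c a) :=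
      congrFun (congrFun (hκ t ht) a) c
    linear_combination t ^ (-(2 * p a)) * (h2 + 2 * p a * h1)
      + (κ t c a + 2 * p c * η t c a) * hr ht.1 a c

end CMCTC

section Data

variable {D : ℕ} {p : Fin D → ℝ} {c : ℝ}

/-- The regularized unknowns of the rescaled mode in terms of the renormalized quantities of the
original mode. -/
noncomputable def dataState (p : Fin D → ℝ) (c : ℝ) (kap Ups : Fin D → Fin D → ℝ) (s f : ℝ) :
    ModeState D :=
  (rescaleMat p c kap, fun i j => c ^ (p i - p j) * Ups j i, s, f)

theorem Gfun_mul (p : Fin D → ℝ) (hc : 0 < c) {s : ℝ} (hs : 0 < s) (i j : Fin D) :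
    Gfun p c i j (c * s) = c ^ (2 * p i - 2 * p j) * weightInt (2 * p i - 2 * p j) s := by
  have h1 := intervalIntegral.mul_integral_comp_mul_left (a := s) (b := 1)
    (f := fun r : ℝ => r ^ (2 * p i - 2 * p j - 1)) (c := c)
  rw [mul_one] at h1
  rw [Gfun, weightInt, ← h1, ← intervalIntegral.integral_const_mul,
    ← intervalIntegral.integral_const_mul]
  refine intervalIntegral.integral_congr fun r hr => ?_
  have hr0 : 0 < r := (lt_min hs one_pos).trans_le hr.1
  rw [Real.mul_rpow hc.le hr0.le, Real.rpow_sub_one hc.ne']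
  field_simp

theorem stateOf_rescale (hc : 0 < c) {s : ℝ} (hs : 0 < s) {η κ : ℝ → Fin D → Fin D → ℝ}
    (φ ψ : ℝ → ℝ) (hη : η (c * s) = etaTranspose p η (c * s)) :
    stateOf p (fun s => rescaleMat p c (η (c * s))) (fun s => rescaleMat p c (κ (c * s)))
        (fun s => φ (c * s)) (fun s => ψ (c * s)) s
      = dataState p c (κ (c * s)) (UpsT p c η κ (c * s)) (ψ (c * s)) (phiT φ ψ c (c * s)) := by
  refine Prod.ext rfl (Prod.ext ?_ (Prod.ext rfl ?_))
  · funext i j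
    have h1 : η (c * s) j i = (c * s) ^ (2 * p j - 2 * p i) * η (c * s) i j :=
      congrFun (congrFun hη j) i
    have h2 : c ^ (p i - p j) * c ^ (2 * p j - 2 * p i) = c ^ (p j - p i) := by
      rw [← Real.rpow_add hc]
      ring_nf
    simp only [stateOf, dataState, UpsT, rescaleMat, Gfun_mul p hc hs]
    rw [h1, Real.mul_rpow hc.le hs.le]
    linear_combination (-s ^ (2 * p j - 2 * p i) * η (c * s) i j
      - weightInt (2 * p j - 2 * p i) s * κ (c * s) i j) * h2
  · have h1 : c / (c * s) = s⁻¹ := by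
      field_simp
    simp only [stateOf, dataState, phiT, h1, Real.log_inv]
    ring

theorem tendsto_dataState {α : Type*} {F : Filter α} {kap Ups : α → Fin D → Fin D → ℝ}
    {s f : α → ℝ} {kap₀ Ups₀ : Fin D → Fin D → ℝ} {s₀ f₀ : ℝ} (hc : 0 < c) :
    Tendsto (fun t => dataState p c (kap t) (Ups t) (s t) (f t)) F
        (𝓝 (dataState p c kap₀ Ups₀ s₀ f₀)) ↔
      (∀ i j, Tendsto (fun t => kap t i j) F (𝓝 (kap₀ i j)) ∧
        Tendsto (fun t => Ups t i j) F (𝓝 (Ups₀ i j))) ∧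
      Tendsto s F (𝓝 s₀) ∧ Tendsto f F (𝓝 f₀) := by
  have hv : ∀ {x : ℝ}, ∀ {g : α → ℝ} {q : ℝ}, Tendsto (fun t => c ^ q * g t) F (𝓝 (c ^ q * x)) ↔
      Tendsto g F (𝓝 x) := by
    intro x g q
    have h0 := (Real.rpow_pos_of_pos hc q).ne'
    refine ⟨fun h => ?_, fun h => h.const_mul _⟩
    simpa [h0] using h.const_mul (c ^ q)⁻¹
  simp only [dataState, nhds_prod_eq, tendsto_prod_iff', tendsto_pi_nhds,
    rescaleMat, hv]
  exact ⟨fun h => ⟨fun i j => ⟨h.1 i j, h.2.1 j i⟩, h.2.2⟩,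
    fun h => ⟨fun i j => (h.1 i j).1, fun i j => (h.1 j i).2, h.2⟩⟩

theorem asymptoticConstraints_dataState (hc : 0 < c) {pphi : ℝ} {l : Fin D → ℝ}
    {kap Ups : Fin D → Fin D → ℝ} {s f : ℝ} (htr : ∑ a, kap a a = 0)
    (hham : -(∑ a, p a * kap a a) + 2 * pphi * s = 0)
    (hmom : ∀ i, momQ p pphi l Ups kap f i = 0)
    (hU : ∀ a b, c ^ (-(2 * p a)) * Ups a b = c ^ (-(2 * p b)) * Ups b a)
    (hκ : ∀ a b, c ^ (-(2 * p a)) * (kap a b + 2 * p a * Ups a b)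
      = c ^ (-(2 * p b)) * (kap b a + 2 * p b * Ups b a)) :
    AsymptoticConstraints p pphi (rescaleVec p c l) (dataState p c kap Ups s f) := by
  have hd : ∀ a, c ^ (p a - p a) * Ups a a = Ups a a := fun a => by simp
  have hr : ∀ a b, c ^ (p a + p b) * c ^ (-(2 * p a)) = c ^ (p b - p a) := fun a b => by
    rw [← Real.rpow_add hc]
    ring_nf
  have hU' : ∀ a b, c ^ (p b - p a) * Ups a b = c ^ (p a - p b) * Ups b a := fun a b => by
    have h2 := hr b a
    rw [add_comm] at h2
    linear_combination c ^ (p a + p b) * hU a b - Ups a b * hr a b + Ups b a * h2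
  refine ⟨?_, ?_, fun i => ?_, ?_⟩
  · simpa only [dataState, rescaleMat_diag] using htr
  · simpa only [dataState, rescaleMat_diag] using hham
  · have h1 := momQ_rescale p pphi hc l Ups kap f i
    rw [hmom i, mul_zero] at h1
    simpa only [momQ, dataState, rescaleMat_diag, hd] using h1
  · refine Prod.ext ?_ (Prod.ext ?_ rfl)
    · funext a b
      have h2 := hr b a
      rw [add_comm] at h2
      simp only [transposeState, dataState, rescaleMat]
      linear_combination (-c ^ (p a + p b)) * hκ a b + (kap a b + 2 * p a * Ups a b) * hr a b
        - (kap b a + 2 * p b * Ups b a) * h2 + 2 * p b * hU' a b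
    · funext a b
      simp only [transposeState, dataState]
      exact hU' a b

end Data

section Energy

variable {D : ℕ}

/-- The Euclidean square of the regularized unknowns. -/
def stateSq (x : ModeState D) : ℝ :=
  (∑ i, ∑ j, (x.1 i j ^ 2 + x.2.1 i j ^ 2)) + x.2.2.1 ^ 2 + x.2.2.2 ^ 2

theorem stateSq_le (x : ModeState D) : stateSq x ≤ (2 * D ^ 2 + 2) * ‖x‖ ^ 2 := by
  have h1 : ∀ i j, x.1 i j ^ 2 + x.2.1 i j ^ 2 ≤ 2 * ‖x‖ ^ 2 := fun i j => by
    have := pow_le_pow_left₀ (abs_nonneg _) (abs_fst_apply_le x i j) 2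
    have := pow_le_pow_left₀ (abs_nonneg _) (abs_snd_fst_apply_le x i j) 2
    simp only [sq_abs] at *
    linarith
  have h2 := pow_le_pow_left₀ (abs_nonneg _) (abs_snd_snd_fst_le x) 2
  have h3 := pow_le_pow_left₀ (abs_nonneg _) (abs_snd_snd_snd_le x) 2
  rw [sq_abs] at h2 h3
  have h4 := Finset.sum_le_sum fun i (_ : i ∈ Finset.univ) =>
    Finset.sum_le_sum fun j (_ : j ∈ Finset.univ) => h1 i j
  simp only [Finset.sum_const, Finset.card_univ, Fintype.card_fin, nsmul_eq_mul] at h4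
  unfold stateSq
  linarith

theorem norm_sq_le_stateSq (x : ModeState D) : ‖x‖ ^ 2 ≤ stateSq x := by
  have h0 : 0 ≤ ∑ i, ∑ j, (x.1 i j ^ 2 + x.2.1 i j ^ 2) :=
    Finset.sum_nonneg fun i _ => Finset.sum_nonneg fun j _ => by positivity
  have hS : 0 ≤ stateSq x := by
    unfold stateSq
    positivity
  have hij : ∀ i j, x.1 i j ^ 2 + x.2.1 i j ^ 2 ≤ stateSq x := fun i j => by
    have h1 : x.1 i j ^ 2 + x.2.1 i j ^ 2 ≤ ∑ j, (x.1 i j ^ 2 + x.2.1 i j ^ 2) :=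
      Finset.single_le_sum (f := fun j => x.1 i j ^ 2 + x.2.1 i j ^ 2)
        (fun _ _ => by positivity) (Finset.mem_univ j)
    have h2 : ∑ j, (x.1 i j ^ 2 + x.2.1 i j ^ 2) ≤ ∑ i, ∑ j, (x.1 i j ^ 2 + x.2.1 i j ^ 2) :=
      Finset.single_le_sum (f := fun i => ∑ j, (x.1 i j ^ 2 + x.2.1 i j ^ 2))
        (fun _ _ => Finset.sum_nonneg fun _ _ => by positivity) (Finset.mem_univ i)
    unfold stateSq
    nlinarith [sq_nonneg x.2.2.1, sq_nonneg x.2.2.2]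
  have key : ‖x‖ ≤ Real.sqrt (stateSq x) := by
    have hs := Real.sqrt_nonneg (stateSq x)
    refine norm_prod_le_iff.2 ⟨?_, norm_prod_le_iff.2 ⟨?_, norm_prod_le_iff.2 ⟨?_, ?_⟩⟩⟩
    · refine (pi_norm_le_iff_of_nonneg hs).2 fun i => (pi_norm_le_iff_of_nonneg hs).2 fun j => ?_
      exact Real.abs_le_sqrt (by linarith [hij i j, sq_nonneg (x.2.1 i j)])
    · refine (pi_norm_le_iff_of_nonneg hs).2 fun i => (pi_norm_le_iff_of_nonneg hs).2 fun j => ?_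
      exact Real.abs_le_sqrt (by linarith [hij i j, sq_nonneg (x.1 i j)])
    · refine Real.abs_le_sqrt ?_
      unfold stateSq
      linarith [sq_nonneg x.2.2.2]
    · refine Real.abs_le_sqrt ?_
      unfold stateSq
      linarith [sq_nonneg x.2.2.1]
  calc ‖x‖ ^ 2 ≤ Real.sqrt (stateSq x) ^ 2 := by gcongr
    _ = _ := Real.sq_sqrt hS

theorem stateSq_dataState (p : Fin D → ℝ) {c : ℝ} (hc : 0 < c) (kap Ups : Fin D → Fin D → ℝ)
    (s f : ℝ) :
    stateSq (dataState p c kap Ups s f)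
      = (∑ i, ∑ j, c ^ (-(2 * p i) + 2 * p j) * (kap i j ^ 2 + Ups i j ^ 2)) + s ^ 2 + f ^ 2 := by
  have hr : ∀ i j, c ^ (-(2 * p i) + 2 * p j) = (c ^ (p j - p i)) ^ 2 := fun i j => by
    rw [pow_two, ← Real.rpow_add hc]
    ring_nf
  have e : (∑ i, ∑ j, (c ^ (p i - p j)) ^ 2 * Ups j i ^ 2)
      = ∑ i, ∑ j, (c ^ (p j - p i)) ^ 2 * Ups i j ^ 2 := Finset.sum_comm
  simp only [stateSq, dataState, rescaleMat, Finset.sum_add_distrib, hr, mul_add, mul_pow, e]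

theorem ElowSys_self (p : Fin D → ℝ) {c : ℝ} (hc : 0 < c) (η κ : ℝ → Fin D → Fin D → ℝ)
    (φ ψ : ℝ → ℝ) :
    ElowSys p c η κ φ ψ c
      = stateSq (dataState p c (κ c) (UpsT p c η κ c) (ψ c) (phiT φ ψ c c)) := by
  rw [stateSq_dataState p hc, ElowSys]

end Energy

section Completeness

variable {D : ℕ} {p : Fin D → ℝ} {pphi : ℝ} {δ : ℝ}

theorem modeBounds_rescaleVec (hD : 2 ≤ D) (hkas : (∑ i, p i ^ 2) + 2 * pphi ^ 2 = 1)
    (hδ : 0 < δ) (hsub : ∀ i j k : Fin D, j ≠ k → δ ≤ 1 + p i - p j - p k)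
    {lam : Fin D → ℤ} {c : ℝ} (hc : 0 < c) (hτ : tau p lam c = 1) :
    ModeBounds p pphi (rescaleVec p c fun k => (lam k : ℝ)) δ := by
  have hsq : ∀ k, p k ^ 2 ≤ ∑ i, p i ^ 2 := fun k =>
    Finset.single_le_sum (f := fun i => p i ^ 2) (fun _ _ => sq_nonneg _) (Finset.mem_univ k)
  have h0 : 0 ≤ ∑ i, p i ^ 2 := Finset.sum_nonneg fun _ _ => sq_nonneg _
  refine ⟨hδ, hsub, fun k => ?_, fun k => ?_, ?_, fun k => ?_⟩
  · have : Nontrivial (Fin D) := Fin.nontrivial_iff_two_le.2 hD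
    obtain ⟨j, hj⟩ := exists_ne k
    linarith [hsub j j k hj]
  · refine (sq_le_one_iff_abs_le_one _).1 ?_
    nlinarith [hsq k, sq_nonneg pphi]
  · refine (sq_le_one_iff_abs_le_one _).1 ?_
    nlinarith [sq_nonneg pphi]
  · refine (sq_le_one_iff_abs_le_one _).1 ?_
    have h1 : tauSq p (rescaleVec p c fun k => (lam k : ℝ)) 1 = 1 := by
      rw [tauSq_rescaleVec p hc one_pos, mul_one, ← tau_sq p lam hc, hτ, one_pow]
    simp only [tauSq, Real.one_rpow, one_mul] at h1
    rw [← h1]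
    exact Finset.single_le_sum (f := fun i => rescaleVec p c (fun k => (lam k : ℝ)) i ^ 2)
      (fun _ _ => sq_nonneg _) (Finset.mem_univ k)

theorem tendsto_comp_const_mul_iff {X : Type*} {F : Filter X} {f : ℝ → X} {c : ℝ} (hc : 0 < c) :
    Tendsto (fun s => f (c * s)) (𝓝[>] 0) F ↔ Tendsto f (𝓝[>] 0) F := by
  have h : ∀ {a : ℝ}, 0 < a → Tendsto (fun s => a * s) (𝓝[>] 0) (𝓝[>] 0) := fun {a} ha => by
    refine tendsto_nhdsWithin_iff.2 ⟨?_, ?_⟩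
    · have := (continuous_const_mul a).tendsto (0 : ℝ)
      rw [mul_zero] at this
      exact this.mono_left nhdsWithin_le_nhds
    · filter_upwards [self_mem_nhdsWithin] with s hs
      exact mul_pos ha hs
  refine ⟨fun hf => ?_, fun hf => hf.comp (h hc)⟩
  refine (hf.comp (h (inv_pos.2 hc))).congr fun s => ?_
  simp [hc.ne']

/-- The regularized unknowns of the rescaled solution converge to the rescaled asymptotic data. -/
theorem tendsto_stateOf_rescale_iff {c : ℝ} (hc : 0 < c) {η κ : ℝ → Fin D → Fin D → ℝ}
    {φ ψ : ℝ → ℝ} (hη : ∀ t ∈ Set.Ioc 0 c, η t = etaTranspose p η t)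
    {kap Ups : Fin D → Fin D → ℝ} {s f : ℝ} :
    Tendsto (stateOf p (fun s => rescaleMat p c (η (c * s))) (fun s => rescaleMat p c (κ (c * s)))
        (fun s => φ (c * s)) (fun s => ψ (c * s))) (𝓝[>] 0) (𝓝 (dataState p c kap Ups s f)) ↔
      (∀ i j, Tendsto (fun t => κ t i j) (𝓝[>] 0) (𝓝 (kap i j)) ∧
        Tendsto (fun t => UpsT p c η κ t i j) (𝓝[>] 0) (𝓝 (Ups i j))) ∧
      Tendsto ψ (𝓝[>] 0) (𝓝 s) ∧ Tendsto (phiT φ ψ c) (𝓝[>] 0) (𝓝 f) := by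
  rw [← tendsto_dataState (F := 𝓝[>] (0 : ℝ)) hc, ← tendsto_comp_const_mul_iff
    (f := fun t => dataState p c (κ t) (UpsT p c η κ t) (ψ t) (phiT φ ψ c t)) hc]
  refine tendsto_congr' ?_
  filter_upwards [Ioc_mem_nhdsGT one_pos] with r hr
  exact stateOf_rescale hc hr.1 φ ψ
    (hη _ ⟨mul_pos hc hr.1, mul_le_of_le_one_right hc.le hr.2⟩)

theorem ModeBounds.exists_isModeEvolution {μ : Fin D → ℝ} (hb : ModeBounds p pphi μ δ)
    (x₀ : ModeState D) :
    ∃ (η κ : ℝ → Fin D → Fin D → ℝ) (φ ψ ν : ℝ → ℝ),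
      IsModeEvolution p pphi μ η κ φ ψ ν 1 ∧ Tendsto (stateOf p η κ φ ψ) (𝓝[>] 0) (𝓝 x₀) := by
  obtain ⟨X, hX₀, hX⟩ := hb.exists_hasDerivAt x₀
  refine ⟨_, _, _, _, _, isModeEvolution_of_hasDerivAt hX, hX₀.congr' ?_⟩
  filter_upwards [self_mem_nhdsWithin] with t ht
  exact (stateOf_of_state p X ht).symm

/-- Existence of a solution with prescribed asymptotic data. -/
theorem exists_isCMCTCSolution {lam : Fin D → ℤ} {c : ℝ} (hc : 0 < c)
    (hb : ModeBounds p pphi (rescaleVec p c fun k => (lam k : ℝ)) δ)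
    (hkas1 : ∑ i, p i = 1) (hkas2 : (∑ i, p i ^ 2) + 2 * pphi ^ 2 = 1)
    {kap Ups : Fin D → Fin D → ℝ} {s f : ℝ}
    (hx₀ : AsymptoticConstraints p pphi (rescaleVec p c fun k => (lam k : ℝ))
      (dataState p c kap Ups s f)) :
    ∃ (η κ : ℝ → Fin D → Fin D → ℝ) (φ ψ ν : ℝ → ℝ),
      IsCMCTCSolution p pphi lam η κ φ ψ ν (Set.Ioc 0 c) ∧
      Tendsto (stateOf p (fun s => rescaleMat p c (η (c * s)))
        (fun s => rescaleMat p c (κ (c * s))) (fun s => φ (c * s)) (fun s => ψ (c * s)))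
        (𝓝[>] 0) (𝓝 (dataState p c kap Ups s f)) := by
  obtain ⟨η, κ, φ, ψ, ν, h, hx⟩ := hb.exists_isModeEvolution (dataState p c kap Ups s f)
  have hc' := inv_pos.2 hc
  have hmem : ∀ t ∈ Set.Ioc 0 c, c⁻¹ * t ∈ Set.Ioc (0 : ℝ) 1 := fun t ht =>
    ⟨mul_pos hc' ht.1, by
      rw [inv_mul_le_iff₀ hc, mul_one]
      exact ht.2⟩
  have hresc := h.rescale hc' (inv_mul_cancel₀ hc.ne')
  rw [rescaleVec_inv p hc] at hresc
  refine ⟨fun t => rescaleMat p c⁻¹ (η (c⁻¹ * t)), fun t => rescaleMat p c⁻¹ (κ (c⁻¹ * t)),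
    fun t => φ (c⁻¹ * t), fun t => ψ (c⁻¹ * t), fun t => ν (c⁻¹ * t),
    hresc.isCMCTCSolution (fun t ht => ?_) (fun t ht => ?_) (fun t ht i => ?_) (fun t ht => ?_)
      (fun t ht => ?_), ?_⟩
  · simp only [rescaleMat_diag]
    exact h.trace_kappa_eq_zero hkas1 hx hx₀ (hmem t ht)
  · have := hamQ_rescale p pphi hc' ht.1 (rescaleVec p c fun k => (lam k : ℝ)) (η (c⁻¹ * t))
      (κ (c⁻¹ * t)) (ψ (c⁻¹ * t))
    rw [rescaleVec_inv p hc] at this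
    rw [this]
    exact (h.constraints_eq_zero hb hkas1 hkas2 hx hx₀ (hmem t ht)).1
  · have := momQ_rescale p pphi hc' (rescaleVec p c fun k => (lam k : ℝ)) (η (c⁻¹ * t))
      (κ (c⁻¹ * t)) (φ (c⁻¹ * t)) i
    rw [rescaleVec_inv p hc] at this
    rw [this, (h.constraints_eq_zero hb hkas1 hkas2 hx hx₀ (hmem t ht)).2, mul_zero]
  · rw [etaTranspose_rescale p hc' ht.1, ← (h.symmetric hb hx hx₀.symmetric (hmem t ht)).1]
  · rw [kapTranspose_rescale p hc' ht.1, ← (h.symmetric hb hx hx₀.symmetric (hmem t ht)).2]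
  · simpa only [inv_mul_cancel_left₀ hc.ne', rescaleMat_inv p hc] using hx

/-- A solution is determined by its asymptotic data. -/
theorem IsCMCTCSolution.eq_of_tendsto {lam : Fin D → ℤ} {c : ℝ} (hc : 0 < c)
    (hb : ModeBounds p pphi (rescaleVec p c fun k => (lam k : ℝ)) δ)
    {η κ η' κ' : ℝ → Fin D → Fin D → ℝ} {φ ψ ν φ' ψ' ν' : ℝ → ℝ}
    (h : IsCMCTCSolution p pphi lam η κ φ ψ ν (Set.Ioc 0 c))
    (h' : IsCMCTCSolution p pphi lam η' κ' φ' ψ' ν' (Set.Ioc 0 c)) {x₀ : ModeState D}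
    (hx : Tendsto (stateOf p (fun s => rescaleMat p c (η (c * s)))
      (fun s => rescaleMat p c (κ (c * s))) (fun s => φ (c * s)) (fun s => ψ (c * s)))
      (𝓝[>] 0) (𝓝 x₀))
    (hx' : Tendsto (stateOf p (fun s => rescaleMat p c (η' (c * s)))
      (fun s => rescaleMat p c (κ' (c * s))) (fun s => φ' (c * s)) (fun s => ψ' (c * s)))
      (𝓝[>] 0) (𝓝 x₀)) {t : ℝ} (ht : t ∈ Set.Ioc 0 c) :
    (∀ i j, η t i j = η' t i j ∧ κ t i j = κ' t i j) ∧ φ t = φ' t ∧ ψ t = ψ' t ∧ ν t = ν' t := by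
  have hmem : c⁻¹ * t ∈ Set.Ioc (0 : ℝ) 1 := ⟨mul_pos (inv_pos.2 hc) ht.1, by
    rw [inv_mul_le_iff₀ hc, mul_one]
    exact ht.2⟩
  have := (h.isModeEvolution.rescale hc (mul_one c)).eq_of_tendsto hb
    (h'.isModeEvolution.rescale hc (mul_one c)) hx hx' hmem
  simp only [mul_inv_cancel_left₀ hc.ne'] at this
  have hcancel : ∀ {h k : Fin D → Fin D → ℝ}, rescaleMat p c h = rescaleMat p c k →
      ∀ i j, h i j = k i j := fun e i j =>
    mul_left_cancel₀ (Real.rpow_pos_of_pos hc _).ne' (congrFun (congrFun e i) j)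
  exact ⟨fun i j => ⟨hcancel this.1 i j, hcancel this.2.1 i j⟩, this.2.2⟩

/-- The energy of a solution is controlled by its asymptotic data. -/
theorem IsCMCTCSolution.ElowSys_le {lam : Fin D → ℤ} {c : ℝ} (hc : 0 < c)
    (hb : ModeBounds p pphi (rescaleVec p c fun k => (lam k : ℝ)) δ)
    {η κ : ℝ → Fin D → Fin D → ℝ} {φ ψ ν : ℝ → ℝ}
    (h : IsCMCTCSolution p pphi lam η κ φ ψ ν (Set.Ioc 0 c)) {x₀ : ModeState D}
    (hx : Tendsto (stateOf p (fun s => rescaleMat p c (η (c * s)))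
      (fun s => rescaleMat p c (κ (c * s))) (fun s => φ (c * s)) (fun s => ψ (c * s)))
      (𝓝[>] 0) (𝓝 x₀)) :
    ElowSys p c η κ φ ψ c
      ≤ (2 * D ^ 2 + 2) * Real.exp (fieldConst D δ / δ) ^ 2 * stateSq x₀ := by
  have hmem : (1 : ℝ) ∈ Set.Ioc (0 : ℝ) 1 := ⟨one_pos, le_rfl⟩
  have hn := hb.norm_le (fun _ hs =>
    (h.isModeEvolution.rescale hc (mul_one c)).hasDerivAt_stateOf hs) hx hmem
  rw [stateOf_rescale hc one_pos φ ψ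
    (h.eta_eq_transpose ⟨mul_pos hc one_pos, (mul_one c).le⟩), mul_one] at hn
  rw [ElowSys_self p hc]
  calc _ ≤ (2 * (D : ℝ) ^ 2 + 2)
        * ‖dataState p c (κ c) (UpsT p c η κ c) (ψ c) (phiT φ ψ c c)‖ ^ 2 := stateSq_le _
    _ ≤ (2 * (D : ℝ) ^ 2 + 2) * (Real.exp (fieldConst D δ / δ) * ‖x₀‖) ^ 2 := by gcongr
    _ = (2 * (D : ℝ) ^ 2 + 2) * Real.exp (fieldConst D δ / δ) ^ 2 * ‖x₀‖ ^ 2 := by ring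
    _ ≤ _ := by
      gcongr
      exact norm_sq_le_stateSq x₀

end Completeness

/-- Proposition `prop:einstein_low_freq_scat`(ii): asymptotic completeness at the
singularity for the linearized Einstein–scalar field system in CMCTC gauge:
asymptotic data satisfying the asymptotic constraints launches a unique λ-mode CMCTC
solution on (0, t_{λ*}] attaining it, with an energy bound. -/
theorem einstein_asymptotic_completeness (D : ℕ) (hD : 2 ≤ D)
    (p : Fin D → ℝ) (pphi : ℝ)
    (hkas1 : ∑ i, p i = 1) (hkas2 : (∑ i, p i ^ 2) + 2 * pphi ^ 2 = 1)
    (hp : ∀ i, p i < 1)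
    (δ : ℝ) (hδ : 0 < δ)
    (hsub : ∀ i j k : Fin D, j ≠ k → δ ≤ 1 + p i - p j - p k) :
    ∃ Clow : ℝ, 0 < Clow ∧
      ∀ (lam : Fin D → ℤ), lam ≠ 0 →
      ∀ tstar : ℝ, 0 < tstar → tstar ≤ 1 → tau p lam tstar = 1 →
      ∀ (kapInf UpsInf : Fin D → Fin D → ℝ) (psiInf phiInf : ℝ),
        (∑ a, kapInf a a = 0) →
        (-(∑ a, p a * kapInf a a) + 2 * pphi * psiInf = 0) →
        (∀ i : Fin D,
          (∑ j, (lam j : ℝ) * kapInf i j)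
            + (lam i : ℝ) * (-(∑ a, p a * UpsInf a a) + 2 * pphi * phiInf)
            + p i * (lam i : ℝ) * (∑ a, UpsInf a a) = 0) →
        (∀ c : Fin D,
          (∑ a, tstar ^ (-(2 * p a)) * (lam a : ℝ) * kapInf a c)
            + tstar ^ (-(2 * p c)) * (lam c : ℝ)
                * (-(∑ a, p a * UpsInf a a) + 2 * pphi * phiInf)
            + 2 * ∑ a, tstar ^ (-(2 * p a)) * p a * (lam a : ℝ) * UpsInf a c = 0) →
        (∀ a c : Fin D,
          tstar ^ (-(2 * p a)) * UpsInf a c = tstar ^ (-(2 * p c)) * UpsInf c a) →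
        (∀ a c : Fin D,
          tstar ^ (-(2 * p a)) * (kapInf a c + 2 * p a * UpsInf a c)
            = tstar ^ (-(2 * p c)) * (kapInf c a + 2 * p c * UpsInf c a)) →
        ∃ (η κ : ℝ → Fin D → Fin D → ℝ) (φ ψ ν : ℝ → ℝ),
          IsCMCTCSolution p pphi lam η κ φ ψ ν (Set.Ioc 0 tstar) ∧
          (∀ i j : Fin D,
            Tendsto (fun t => κ t i j) (𝓝[>] (0:ℝ)) (𝓝 (kapInf i j)) ∧
            Tendsto (fun t => UpsT p tstar η κ t i j) (𝓝[>] (0:ℝ)) (𝓝 (UpsInf i j))) ∧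
          Tendsto ψ (𝓝[>] (0:ℝ)) (𝓝 psiInf) ∧
          Tendsto (phiT φ ψ tstar) (𝓝[>] (0:ℝ)) (𝓝 phiInf) ∧
          (∀ (η' κ' : ℝ → Fin D → Fin D → ℝ) (φ' ψ' ν' : ℝ → ℝ),
            IsCMCTCSolution p pphi lam η' κ' φ' ψ' ν' (Set.Ioc 0 tstar) →
            (∀ i j : Fin D,
              Tendsto (fun t => κ' t i j) (𝓝[>] (0:ℝ)) (𝓝 (kapInf i j)) ∧
              Tendsto (fun t => UpsT p tstar η' κ' t i j) (𝓝[>] (0:ℝ)) (𝓝 (UpsInf i j))) →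
            Tendsto ψ' (𝓝[>] (0:ℝ)) (𝓝 psiInf) →
            Tendsto (phiT φ' ψ' tstar) (𝓝[>] (0:ℝ)) (𝓝 phiInf) →
            ∀ t ∈ Set.Ioc (0:ℝ) tstar,
              (∀ i j : Fin D, η' t i j = η t i j ∧ κ' t i j = κ t i j) ∧
              φ' t = φ t ∧ ψ' t = ψ t ∧ ν' t = ν t) ∧
          ElowSys p tstar η κ φ ψ tstar ≤
            Clow * ((∑ i, ∑ j, tstar ^ (-(2 * p i) + 2 * p j)
                * ((kapInf i j) ^ 2 + (UpsInf i j) ^ 2))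
              + psiInf ^ 2 + phiInf ^ 2) := by
  refine ⟨(2 * (D : ℝ) ^ 2 + 2) * Real.exp (fieldConst D δ / δ) ^ 2, by positivity, ?_⟩
  intro lam _ c hc _ hτ kap Ups s f htr hham hmom _ hU hκ
  have hb := modeBounds_rescaleVec hD hkas2 hδ hsub hc hτ
  have hx₀ := asymptoticConstraints_dataState (s := s) hc htr hham hmom hU hκ
  obtain ⟨η, κ, φ, ψ, ν, h, hx⟩ := exists_isCMCTCSolution hc hb hkas1 hkas2 hx₀
  obtain ⟨hlim, hψ, hφ⟩ := (tendsto_stateOf_rescale_iff hc fun t ht => h.eta_eq_transpose ht).1 hx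
  refine ⟨η, κ, φ, ψ, ν, h, hlim, hψ, hφ, ?_, ?_⟩
  · intro η' κ' φ' ψ' ν' h' hlim' hψ' hφ' t ht
    have hx' := (tendsto_stateOf_rescale_iff hc fun t ht => h'.eta_eq_transpose ht).2
      ⟨hlim', hψ', hφ'⟩
    exact h'.eq_of_tendsto hc hb h hx' hx ht
  · rw [← stateSq_dataState p hc]
    exact h.ElowSys_le hc hb hx
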